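/- arXiv:1101.4195 — 4 statements merged into one kernel-verified Lean document; each statement's English description precedes it below -/
import Mathlib

section
/- Let (Ω,μ) and (Ω',μ') be measure spaces and let T : L∞(μ;ℝ) → L¹(μ';ℝ) be a bounded linear operator. Then for every n and every finite family x_1, …, x_n ∈ L∞(μ;ℝ) one has ‖(∑_{j=1}^n |T x_j|²)^{1/2}‖_{L¹(μ')} ≤ K·‖T‖·‖(∑_{j=1}^n |x_j|²)^{1/2}‖_{L∞(μ)}, where K = π/(2·log(1+√2)) and the square functions are formed pointwise almost everywhere from representatives. -/
open MeasureTheory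

namespace Grothendieck

open ProbabilityTheory

lemma measurable_coe_sign : Measurable fun x : ℝ => ((SignType.sign x : SignType) : ℝ) := by
  have : (fun x : ℝ => ((SignType.sign x : SignType) : ℝ)) =
      fun x => if 0 < x then 1 else if x < 0 then -1 else 0 := by
    funext x
    rw [sign_apply]
    split_ifs <;> simp
  rw [this]
  exact Measurable.ite measurableSet_Ioi measurable_const
    (Measurable.ite measurableSet_Iio measurable_const measurable_const)

lemma abs_coe_sign_le_one (s : SignType) : |(s : ℝ)| ≤ 1 := by
  cases s <;> simp

lemma coe_sign_injective : Function.Injective ((↑) : SignType → ℝ) := by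
  intro s t h
  cases s <;> cases t <;> first | rfl | norm_num at h

lemma integral_sign_cos_mul_sign_cos_sub {θ : ℝ} (h0 : 0 ≤ θ) (hπ : θ ≤ Real.pi) :
    ∫ φ in -Real.pi..Real.pi, ((SignType.sign (Real.cos φ) : SignType) : ℝ) *
      (SignType.sign (Real.cos (φ - θ)) : SignType) = 2 * Real.pi - 4 * θ := by
  set F : ℝ → ℝ := fun φ => ((SignType.sign (Real.cos φ) : SignType) : ℝ) *
      (SignType.sign (Real.cos (φ - θ)) : SignType) with hF
  have hm : Measurable F := (measurable_coe_sign.comp (by fun_prop)).mul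
    (measurable_coe_sign.comp (by fun_prop))
  have hint (a b : ℝ) : IntervalIntegrable F volume a b := by
    refine (intervalIntegrable_const (c := (1 : ℝ))).mono_fun hm.aestronglyMeasurable ?_
    refine Filter.Eventually.of_forall fun φ => ?_
    simp only [hF, norm_mul, norm_one]
    exact mul_le_one₀ (abs_coe_sign_le_one _) (norm_nonneg _) (abs_coe_sign_le_one _)
  have hper : Function.Periodic F Real.pi := fun φ => by
    simp [hF, add_sub_right_comm, Real.cos_add_pi, Left.sign_neg]
  have h1 := hper.intervalIntegral_add_zsmul_eq 2 (-Real.pi) hint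
  have h2 := hper.intervalIntegral_add_eq (-Real.pi) (-(Real.pi / 2))
  rw [show -Real.pi + (2 : ℤ) • Real.pi = Real.pi by simp; ring] at h1
  rw [h1, h2, ← intervalIntegral.integral_add_adjacent_intervals
    (hint _ (θ - Real.pi / 2)) (hint _ _)]
  have h3 : ∫ φ in -(Real.pi / 2)..(θ - Real.pi / 2), F φ =
      ∫ φ in -(Real.pi / 2)..(θ - Real.pi / 2), (-1 : ℝ) := by
    refine intervalIntegral.integral_congr_ae ?_
    filter_upwards [Measure.ae_ne volume (θ - Real.pi / 2)] with φ hφ hmem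
    rw [Set.uIoc_of_le (by linarith)] at hmem
    have hlt := lt_of_le_of_ne hmem.2 hφ
    have c1 : 0 < Real.cos φ := Real.cos_pos_of_mem_Ioo ⟨hmem.1, by linarith⟩
    have c2 : Real.cos (φ - θ) < 0 := by
      rw [← Real.cos_neg]
      exact Real.cos_neg_of_pi_div_two_lt_of_lt (by linarith) (by linarith [hmem.1])
    simp [hF, sign_pos c1, sign_neg c2]
  have h4 : ∫ φ in (θ - Real.pi / 2)..(-(Real.pi / 2) + Real.pi), F φ =
      ∫ φ in (θ - Real.pi / 2)..(-(Real.pi / 2) + Real.pi), (1 : ℝ) := by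
    refine intervalIntegral.integral_congr_ae ?_
    filter_upwards [Measure.ae_ne volume (-(Real.pi / 2) + Real.pi)] with φ hφ hmem
    rw [Set.uIoc_of_le (by linarith)] at hmem
    have hlt := lt_of_le_of_ne hmem.2 hφ
    have c1 : 0 < Real.cos φ := Real.cos_pos_of_mem_Ioo ⟨by linarith [hmem.1], by linarith⟩
    have c2 : 0 < Real.cos (φ - θ) :=
      Real.cos_pos_of_mem_Ioo ⟨by linarith [hmem.1], by linarith⟩
    simp [hF, sign_pos c1, sign_pos c2]
  rw [h3, h4]
  simp
  ring

lemma exists_integral_gaussianReal_prod_eq :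
    ∃ A : ℝ, ∀ (f : ℝ × ℝ → ℝ) (F : ℝ → ℝ),
      (∀ r φ, 0 < r → f (r * Real.cos φ, r * Real.sin φ) = F φ) →
      ∫ p, f p ∂((gaussianReal 0 1).prod (gaussianReal 0 1)) =
        A * ∫ φ in -Real.pi..Real.pi, F φ := by
  refine ⟨∫ r in Set.Ioi (0 : ℝ), r * ((√(2 * Real.pi))⁻¹ ^ 2 * Real.exp (-r ^ 2 / 2)),
    fun f F hfF => ?_⟩
  rw [gaussianReal_of_var_ne_zero 0 one_ne_zero,
    prod_withDensity (measurable_gaussianPDF _ _) (measurable_gaussianPDF _ _),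
    integral_withDensity_eq_integral_toReal_smul (by fun_prop)
      (Filter.Eventually.of_forall fun p => ENNReal.mul_lt_top gaussianPDF_lt_top
        gaussianPDF_lt_top), ← Measure.volume_eq_prod, ← integral_comp_polarCoord_symm,
    intervalIntegral.integral_of_le (by linarith [Real.pi_pos]),
    ← integral_Ioc_eq_integral_Ioo.symm, ← setIntegral_prod_mul, ← Measure.volume_eq_prod]
  refine setIntegral_congr_fun (measurableSet_Ioi.prod measurableSet_Ioo) fun p hp => ?_
  have hr : 0 < p.1 := hp.1
  have hexp : Real.exp (-p.1 ^ 2 / 2) =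
      Real.exp (-(p.1 * Real.cos p.2) ^ 2 / 2) * Real.exp (-(p.1 * Real.sin p.2) ^ 2 / 2) := by
    rw [← Real.exp_add]
    congr 1
    linear_combination (p.1 ^ 2 / 2) * Real.sin_sq_add_cos_sq p.2
  simp only [polarCoord_symm_apply, hfF _ _ hr, ENNReal.toReal_mul, toReal_gaussianPDF,
    gaussianPDFReal, smul_eq_mul, hexp, sub_zero, NNReal.coe_one, mul_one]
  ring

lemma integral_sign_mul_sign_gaussianReal_prod {θ : ℝ} (h0 : 0 ≤ θ) (hπ : θ ≤ Real.pi) :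
    ∫ p, ((SignType.sign p.1 : SignType) : ℝ) *
        (SignType.sign (Real.cos θ * p.1 + Real.sin θ * p.2) : SignType)
      ∂((gaussianReal 0 1).prod (gaussianReal 0 1)) = 1 - 2 * θ / Real.pi := by
  obtain ⟨A, hA⟩ := exists_integral_gaussianReal_prod_eq
  have h1 := hA (fun _ => 1) (fun _ => 1) (fun _ _ _ => rfl)
  rw [hA _ (fun φ => ((SignType.sign (Real.cos φ) : SignType) : ℝ) *
      (SignType.sign (Real.cos (φ - θ)) : SignType)),
    integral_sign_cos_mul_sign_cos_sub h0 hπ]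
  · have hp := Real.pi_pos
    simp at h1
    field_simp
    linear_combination (-Real.pi + 2 * θ) * h1
  · intro r φ hr
    have : Real.cos θ * (r * Real.cos φ) + Real.sin θ * (r * Real.sin φ) =
        r * Real.cos (φ - θ) := by
      rw [Real.cos_sub]; ring
    simp [this, sign_mul, sign_pos hr]

variable {E : Type*} [NormedAddCommGroup E] [InnerProductSpace ℝ E] [FiniteDimensional ℝ E]
  [MeasurableSpace E] [BorelSpace E]

lemma map_inner_stdGaussian {u : E} (hu : ‖u‖ = 1) :
    (stdGaussian E).map (fun g => inner ℝ u g) = gaussianReal 0 1 := by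
  have h := IsGaussian.map_eq_gaussianReal (μ := stdGaussian E) (innerSL ℝ u)
  rw [integral_strongDual_stdGaussian, variance_dual_stdGaussian, innerSL_apply_norm, hu] at h
  simpa using h

lemma map_inner_prod_stdGaussian {u w : E} (hu : ‖u‖ = 1) (hw : ‖w‖ = 1)
    (huw : inner ℝ u w = 0) :
    (stdGaussian E).map (fun g => ((inner ℝ u g : ℝ), (inner ℝ w g : ℝ))) =
      (gaussianReal 0 1).prod (gaussianReal 0 1) := by
  have hg : HasGaussianLaw (fun g : E => ((inner ℝ u g : ℝ), (inner ℝ w g : ℝ)))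
      (stdGaussian E) := by
    have : IsGaussian ((stdGaussian E).map ((innerSL ℝ u).prod (innerSL ℝ w))) := inferInstance
    exact ⟨this⟩
  have hi := hg.indepFun_of_covariance_eq_zero (by
    rw [← covarianceBilin_apply_eq_cov IsGaussian.memLp_two_id, covarianceBilin_stdGaussian]
    exact huw)
  rw [(indepFun_iff_map_prod_eq_prod_map_map (by fun_prop) (by fun_prop)).1 hi,
    map_inner_stdGaussian hu, map_inner_stdGaussian hw]

/-- **Grothendieck's identity**. -/
lemma integral_sign_inner_mul_sign_inner {u v : E} (hu : ‖u‖ = 1) (hv : ‖v‖ = 1) :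
    ∫ g, ((SignType.sign (inner ℝ u g : ℝ) : SignType) : ℝ) *
        (SignType.sign (inner ℝ v g : ℝ) : SignType) ∂(stdGaussian E) =
      2 / Real.pi * Real.arcsin (inner ℝ u v) := by
  set ρ : ℝ := inner ℝ u v with hρ
  set θ := Real.arccos ρ with hθ
  have hρ1 : |ρ| ≤ 1 := by simpa [hu, hv] using abs_real_inner_le_norm u v
  have hcos : Real.cos θ = ρ := Real.cos_arccos (abs_le.1 hρ1).1 (abs_le.1 hρ1).2
  have huu : inner ℝ u u = (1 : ℝ) := by simp [hu]
  have hvv : inner ℝ v v = (1 : ℝ) := by simp [hv]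
  have hnorm : ‖v - ρ • u‖ = Real.sin θ := by
    rw [hθ, Real.sin_arccos, norm_eq_sqrt_real_inner]
    congr 1
    rw [inner_sub_left, inner_sub_right, inner_sub_right]
    simp only [real_inner_smul_left, real_inner_smul_right, huu, hvv, real_inner_comm u v, ← hρ]
    ring
  have key := integral_sign_mul_sign_gaussianReal_prod (θ := θ) (Real.arccos_nonneg _)
    (Real.arccos_le_pi _)
  have hval : 1 - 2 * θ / Real.pi = 2 / Real.pi * Real.arcsin ρ := by
    rw [Real.arcsin_eq_pi_div_two_sub_arccos, ← hθ]
    field_simp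
  rw [← hval, ← key]
  by_cases hs : Real.sin θ = 0
  · have hv' : v = ρ • u := by rwa [hs, norm_eq_zero, sub_eq_zero] at hnorm
    have hfst := measurePreserving_fst (μ := gaussianReal 0 1) (ν := gaussianReal 0 1)
    simp only [hs, zero_mul, add_zero, hcos]
    have hm : Measurable fun x : ℝ => ((SignType.sign x : SignType) : ℝ) *
        (SignType.sign (ρ * x) : SignType) :=
      measurable_coe_sign.mul (measurable_coe_sign.comp (by fun_prop))
    rw [← integral_map (f := fun x : ℝ => ((SignType.sign x : SignType) : ℝ) *
        (SignType.sign (ρ * x) : SignType)) measurable_fst.aemeasurable hm.aestronglyMeasurable,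
      hfst.map_eq, ← map_inner_stdGaussian hu,
      integral_map (by fun_prop) hm.aestronglyMeasurable]
    simp [hv', real_inner_smul_left]
  · set w := (Real.sin θ)⁻¹ • (v - ρ • u) with hw
    have hw1 : ‖w‖ = 1 := by
      rw [hw, norm_smul, hnorm, norm_inv, Real.norm_of_nonneg (hnorm ▸ norm_nonneg _),
        inv_mul_cancel₀ hs]
    have huw : inner ℝ u w = 0 := by
      simp [hw, real_inner_smul_right, inner_sub_right, hu, ← hρ]
    have hv' : v = Real.cos θ • u + Real.sin θ • w := by
      rw [hw, smul_inv_smul₀ hs, hcos]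
      abel
    have hm : Measurable fun p : ℝ × ℝ => ((SignType.sign p.1 : SignType) : ℝ) *
        (SignType.sign (Real.cos θ * p.1 + Real.sin θ * p.2) : SignType) :=
      (measurable_coe_sign.comp (by fun_prop)).mul (measurable_coe_sign.comp (by fun_prop))
    rw [← map_inner_prod_stdGaussian hu hw1 huw,
      integral_map (by fun_prop) hm.aestronglyMeasurable]
    refine integral_congr_ae (Filter.Eventually.of_forall fun g => ?_)
    have : (inner ℝ v g : ℝ) = Real.cos θ * inner ℝ u g + Real.sin θ * inner ℝ w g := by
      conv_lhs => rw [hv']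
      rw [inner_add_left, real_inner_smul_left, real_inner_smul_left]
    simp only [this]

lemma sum_tensor_mul_tensor {n : ℕ} (k : ℕ) (u v : EuclideanSpace ℝ (Fin n)) :
    ∑ s : Fin k → Fin n, (∏ i, u (s i)) * ∏ i, v (s i) = (inner ℝ u v : ℝ) ^ k := by
  have : (inner ℝ u v : ℝ) = ∑ j, u j * v j := by
    simp [PiLp.inner_apply, mul_comm]
  rw [this, Finset.sum_pow', Fintype.piFinset_univ]
  simp only [Finset.prod_mul_distrib]

/-- Odd tensor powers of `u`, weighted so that their squared lengths are the terms of the power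
series of `sinh (c * ‖u‖ ^ 2)`, with additional scalars `ε`. -/
noncomputable def oddTensors {n : ℕ} (c : ℝ) (ε : ℕ → ℝ) (u : EuclideanSpace ℝ (Fin n)) :
    (Σ k : ℕ, Fin (2 * k + 1) → Fin n) → ℝ :=
  fun s => ε s.1 * √(c ^ (2 * s.1 + 1) / (2 * s.1 + 1).factorial) * ∏ i, u (s.2 i)

lemma sum_oddTensors_mul_oddTensors {n : ℕ} {c : ℝ} (hc : 0 ≤ c) (ε δ : ℕ → ℝ)
    (u v : EuclideanSpace ℝ (Fin n)) (k : ℕ) :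
    ∑ s : Fin (2 * k + 1) → Fin n, oddTensors c ε u ⟨k, s⟩ * oddTensors c δ v ⟨k, s⟩ =
      ε k * δ k * (c * inner ℝ u v) ^ (2 * k + 1) / (2 * k + 1).factorial := by
  have hs := Real.mul_self_sqrt (show 0 ≤ c ^ (2 * k + 1) / (2 * k + 1).factorial by positivity)
  calc _ = ε k * δ k * (√(c ^ (2 * k + 1) / (2 * k + 1).factorial) *
        √(c ^ (2 * k + 1) / (2 * k + 1).factorial)) *
        ∑ s : Fin (2 * k + 1) → Fin n, (∏ i, u (s i)) * ∏ i, v (s i) := by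
        rw [Finset.mul_sum]
        refine Finset.sum_congr rfl fun s _ => ?_
        simp only [oddTensors]
        ring
    _ = _ := by
        rw [hs, sum_tensor_mul_tensor]
        ring

lemma memℓp_oddTensors {n : ℕ} {c : ℝ} (hc : 0 ≤ c) {ε : ℕ → ℝ} (hε : ∀ k, ε k * ε k = 1)
    (u : EuclideanSpace ℝ (Fin n)) : Memℓp (oddTensors c ε u) 2 := by
  refine memℓp_gen ?_
  have h2 : ∀ s, ‖oddTensors c ε u s‖ ^ (2 : ENNReal).toReal =
      oddTensors c ε u s * oddTensors c ε u s := fun s => by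
    simp [sq]
  simp only [h2]
  refine (summable_sigma_of_nonneg fun s => mul_self_nonneg _).2
    ⟨fun k => (hasSum_fintype _).summable, ?_⟩
  simp only [tsum_fintype, sum_oddTensors_mul_oddTensors hc, hε, one_mul]
  exact (Real.hasSum_sinh _).summable

/-- **Krivine's Hilbert space maps**. -/
lemma exists_inner_eq_sin (n : ℕ) {c : ℝ} (hc : 0 ≤ c) :
    ∃ Φ Ψ : EuclideanSpace ℝ (Fin n) →
        lp (fun _ : Σ k : ℕ, Fin (2 * k + 1) → Fin n => ℝ) 2,
      (∀ u v, (inner ℝ (Φ u) (Ψ v) : ℝ) = Real.sin (c * inner ℝ u v)) ∧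
      (∀ u, ‖Φ u‖ ^ 2 = Real.sinh (c * ‖u‖ ^ 2)) ∧
      ∀ u, ‖Ψ u‖ ^ 2 = Real.sinh (c * ‖u‖ ^ 2) := by
  have h1 : ∀ k : ℕ, (1 : ℝ) * 1 = 1 := by simp
  have h2 : ∀ k : ℕ, (-1 : ℝ) ^ k * (-1) ^ k = 1 := fun k => by rw [← mul_pow]; simp
  have key (ε δ : ℕ → ℝ) (hε : ∀ k, ε k * ε k = 1) (hδ : ∀ k, δ k * δ k = 1)
      (u v : EuclideanSpace ℝ (Fin n)) :
      HasSum (fun k => ε k * δ k * (c * inner ℝ u v) ^ (2 * k + 1) / (2 * k + 1).factorial)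
        (inner ℝ (⟨_, memℓp_oddTensors hc hε u⟩ : lp (fun _ => ℝ) 2)
          (⟨_, memℓp_oddTensors hc hδ v⟩ : lp (fun _ => ℝ) 2)) := by
    have h := (lp.hasSum_inner (𝕜 := ℝ) (⟨_, memℓp_oddTensors hc hε u⟩ : lp (fun _ => ℝ) 2)
      ⟨_, memℓp_oddTensors hc hδ v⟩).sigma fun k => hasSum_fintype _
    simp only [← sum_oddTensors_mul_oddTensors hc]
    simpa [mul_comm] using h
  refine ⟨fun u => ⟨_, memℓp_oddTensors hc h1 u⟩, fun u => ⟨_, memℓp_oddTensors hc h2 u⟩,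
    fun u v => (key _ _ h1 h2 u v).unique ?_, fun u => ?_, fun u => ?_⟩
  · simpa using Real.hasSum_sin (c * inner ℝ u v)
  · rw [← real_inner_self_eq_norm_sq]
    refine (key _ _ h1 h1 u u).unique ?_
    simpa using Real.hasSum_sinh (c * ‖u‖ ^ 2)
  · rw [← real_inner_self_eq_norm_sq]
    refine (key _ _ h2 h2 u u).unique ?_
    simpa [h2] using Real.hasSum_sinh (c * ‖u‖ ^ 2)

/-- Finitely many vectors in the unit ball of a Hilbert space can be replaced by unit vectors of a
finite-dimensional space, in such a way that their inner products with any other element of the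
unit ball are inner products with a unit vector. -/
lemma exists_finiteDimensional_unit {H ι : Type} [NormedAddCommGroup H] [InnerProductSpace ℝ H]
    [Finite ι] (a : ι → H) (ha : ∀ i, ‖a i‖ ≤ 1) :
    ∃ (V : Type) (_ : NormedAddCommGroup V) (_ : InnerProductSpace ℝ V)
      (_ : FiniteDimensional ℝ V) (u : ι → V), (∀ i, ‖u i‖ = 1) ∧
      ∀ q : H, ‖q‖ ≤ 1 → ∃ w : V, ‖w‖ = 1 ∧ ∀ i, (inner ℝ (u i) w : ℝ) = inner ℝ (a i) q := by
  set S : Submodule ℝ H := Submodule.span ℝ (Set.range a) with hS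
  have : FiniteDimensional ℝ S := FiniteDimensional.span_of_finite ℝ (Set.finite_range a)
  let b : ι → S := fun i => ⟨a i, Submodule.subset_span ⟨i, rfl⟩⟩
  refine ⟨WithLp 2 (S × EuclideanSpace ℝ (Fin 2)), inferInstance, inferInstance, inferInstance,
    fun i => WithLp.toLp 2 (b i, !₂[√(1 - ‖a i‖ ^ 2), 0]), fun i => ?_, fun q hq => ?_⟩
  · have h : (0 : ℝ) ≤ 1 - ‖a i‖ ^ 2 := by nlinarith [ha i, norm_nonneg (a i)]
    rw [← sq_eq_sq₀ (norm_nonneg _) zero_le_one, WithLp.prod_norm_sq_eq_of_L2]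
    simp [b, EuclideanSpace.norm_sq_eq, Real.sq_sqrt h]
  · set r : S := S.orthogonalProjectionOnto q with hr
    have hr1 : ‖(r : H)‖ ≤ 1 := (S.norm_orthogonalProjectionOnto_apply_le q).trans hq
    have h : (0 : ℝ) ≤ 1 - ‖(r : H)‖ ^ 2 := by nlinarith [norm_nonneg (r : H)]
    refine ⟨WithLp.toLp 2 (r, !₂[0, √(1 - ‖(r : H)‖ ^ 2)]), ?_, fun i => ?_⟩
    · rw [← sq_eq_sq₀ (norm_nonneg _) zero_le_one, WithLp.prod_norm_sq_eq_of_L2]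
      simp [EuclideanSpace.norm_sq_eq, Real.sq_sqrt h]
    · rw [WithLp.prod_inner_apply]
      simp [PiLp.inner_apply, Fin.sum_univ_two, hr, b]

/-- A finite-dimensional form of **Grothendieck's inequality** with Krivine's constant: the norm of
a combination of vectors in the unit ball is controlled by averages over signs. -/
lemma exists_sign_average_bound {n : ℕ} {ι : Type} [Fintype ι] [DecidableEq ι]
    (a : ι → EuclideanSpace ℝ (Fin n)) (ha : ∀ i, ‖a i‖ ≤ 1) :
    ∃ p : (ι → SignType) → ℝ, (∀ σ, 0 ≤ p σ) ∧ ∑ σ, p σ = 1 ∧ ∀ h : ι → ℝ,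
      ‖∑ i, h i • a i‖ ≤ Real.pi / (2 * Real.log (1 + √2)) *
        ∑ σ, p σ * |∑ i, h i * (σ i : ℝ)| := by
  set c := Real.arsinh 1 with hc
  have hclog : Real.log (1 + √2) = c := by rw [hc, Real.arsinh]; norm_num
  have hsinh : Real.sinh c = 1 := Real.sinh_arsinh 1
  have hc0 : 0 < c := Real.arsinh_pos_iff.2 one_pos
  have hc1 : c ≤ Real.pi / 2 := by
    have := Real.self_le_sinh_iff.2 hc0.le
    linarith [Real.pi_gt_three]
  have hball {u : EuclideanSpace ℝ (Fin n)} (hu : ‖u‖ ≤ 1) : Real.sinh (c * ‖u‖ ^ 2) ≤ 1 := by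
    rw [← hsinh, Real.sinh_le_sinh]
    exact mul_le_of_le_one_right hc0.le (pow_le_one₀ (norm_nonneg _) hu)
  obtain ⟨Φ, Ψ, hΦΨ, hΦ, hΨ⟩ := exists_inner_eq_sin n hc0.le
  obtain ⟨V, _, _, _, u, hu, hw⟩ := exists_finiteDimensional_unit (fun i => Φ (a i)) fun i =>
    (sq_le_one_iff₀ (norm_nonneg _)).1 ((hΦ _).trans_le (hball (ha i)))
  borelize V
  let _ : MeasurableSpace (ι → SignType) := ⊤
  let s : V → ι → SignType := fun g i => SignType.sign (inner ℝ (u i) g : ℝ)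
  have hsm (i : ι) : Measurable fun g : V => ((s g i : SignType) : ℝ) :=
    measurable_coe_sign.comp (by fun_prop)
  have hs : Measurable s := by
    refine measurable_to_countable' fun τ => ?_
    have : s ⁻¹' {τ} =
        ⋂ i, (fun g : V => ((s g i : SignType) : ℝ)) ⁻¹' {((τ i : SignType) : ℝ)} := by
      ext g
      simp [funext_iff, coe_sign_injective.eq_iff]
    rw [this]
    exact MeasurableSet.iInter fun i => hsm i (measurableSet_singleton _)
  have hP : IsProbabilityMeasure ((stdGaussian V).map s) :=
    Measure.isProbabilityMeasure_map hs.aemeasurable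
  have hint (f : (ι → SignType) → ℝ) :
      ∫ g, f (s g) ∂(stdGaussian V) = ∑ σ, ((stdGaussian V).map s).real {σ} * f σ := by
    rw [← integral_map (f := f) hs.aemeasurable measurable_from_top.aestronglyMeasurable,
      integral_fintype (Integrable.of_finite)]
    simp
  refine ⟨fun σ => ((stdGaussian V).map s).real {σ}, fun σ => measureReal_nonneg, ?_, fun h => ?_⟩
  · simpa only [mul_one, integral_const, probReal_univ, one_smul] using (hint fun _ => 1).symm
  rw [hclog, ← hint fun σ => |∑ i, h i * (σ i : ℝ)|]
  set x := ∑ i, h i • a i with hx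
  by_cases hx0 : x = 0
  · rw [hx0, norm_zero]
    have : 0 ≤ ∫ g, |∑ i, h i * ((s g i : SignType) : ℝ)| ∂(stdGaussian V) :=
      integral_nonneg fun g => abs_nonneg _
    have := Real.pi_pos
    positivity
  set y := ‖x‖⁻¹ • x with hy
  have hy1 : ‖y‖ = 1 := by
    rw [hy, norm_smul, norm_inv, norm_norm, inv_mul_cancel₀ (norm_ne_zero_iff.2 hx0)]
  obtain ⟨w, hw1, hw⟩ := hw (Ψ y) ((sq_le_one_iff₀ (norm_nonneg _)).1
    ((hΨ _).trans_le (hball hy1.le)))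
  have hterm (i : ι) : (inner ℝ (a i) y : ℝ) = Real.pi / (2 * c) *
      ∫ g, ((s g i : SignType) : ℝ) * (SignType.sign (inner ℝ w g : ℝ) : SignType)
        ∂(stdGaussian V) := by
    have hi : |(inner ℝ (a i) y : ℝ)| ≤ 1 := (abs_real_inner_le_norm _ _).trans
      (by rw [hy1, mul_one]; exact ha i)
    rw [abs_le] at hi
    rw [integral_sign_inner_mul_sign_inner (hu i) hw1, hw, hΦΨ, Real.arcsin_sin (by nlinarith)
      (by nlinarith)]
    have := Real.pi_pos
    field_simp
  have hwm : Measurable fun g : V => ((SignType.sign (inner ℝ w g : ℝ) : SignType) : ℝ) :=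
    measurable_coe_sign.comp (by fun_prop)
  have hi (i : ι) : Integrable (fun g : V => ((s g i : SignType) : ℝ)) (stdGaussian V) :=
    .of_bound (hsm i).aestronglyMeasurable 1 (.of_forall fun _ => abs_coe_sign_le_one _)
  have hiw (i : ι) : Integrable (fun g : V => ((s g i : SignType) : ℝ) *
      (SignType.sign (inner ℝ w g : ℝ) : SignType)) (stdGaussian V) :=
    (hi i).mul_bdd (c := 1) hwm.aestronglyMeasurable (.of_forall fun _ => abs_coe_sign_le_one _)
  have hxy : ‖x‖ = inner ℝ x y := by
    rw [hy, real_inner_smul_right, real_inner_self_eq_norm_sq]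
    field_simp
  calc ‖x‖ = ∑ i, h i * inner ℝ (a i) y := by
        rw [hxy, hx, sum_inner]
        simp [real_inner_smul_left]
    _ = Real.pi / (2 * c) * ∫ g, (∑ i, h i * ((s g i : SignType) : ℝ)) *
          (SignType.sign (inner ℝ w g : ℝ) : SignType) ∂(stdGaussian V) := by
        simp only [hterm, Finset.sum_mul, mul_assoc]
        rw [integral_finsetSum _ fun i _ => (hiw i).const_mul _, Finset.mul_sum]
        refine Finset.sum_congr rfl fun i _ => ?_
        rw [integral_const_mul]
        ring
    _ ≤ Real.pi / (2 * c) * ∫ g, |∑ i, h i * ((s g i : SignType) : ℝ)| ∂(stdGaussian V) := by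
        have hsum := integrable_finsetSum Finset.univ fun i _ => (hi i).const_mul (h i)
        refine mul_le_mul_of_nonneg_left (integral_mono
          (hsum.mul_bdd (c := 1) hwm.aestronglyMeasurable
            (.of_forall fun _ => abs_coe_sign_le_one _)) hsum.abs fun g => ?_)
          (by have := Real.pi_pos; positivity)
        refine (le_abs_self _).trans ?_
        rw [abs_mul]
        exact mul_le_of_le_one_right (abs_nonneg _) (abs_coe_sign_le_one _)

/-- A measurable map with values in a compact set is uniformly approximated by simple functions
with values in this set. -/
lemma exists_simpleFunc_norm_sub_le {Ω E : Type*} [MeasurableSpace Ω] {μ : Measure Ω}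
    [NormedAddCommGroup E] [MeasurableSpace E] [BorelSpace E] {K : Set E} (hK : IsCompact K)
    (h0 : 0 ∈ K) {X : Ω → E} (hX : Measurable X) (hXK : ∀ᵐ ω ∂μ, X ω ∈ K) {δ : ℝ} (hδ : 0 < δ) :
    ∃ s : SimpleFunc Ω E, (∀ ω, s ω ∈ K) ∧ ∀ᵐ ω ∂μ, ‖s ω - X ω‖ ≤ δ := by
  obtain ⟨t, htK, ht, hcov⟩ := hK.finite_cover_balls hδ
  let eq := ht.toFinset.equivFin
  let e : ℕ → E := fun k => if h : k < ht.toFinset.card then eq.symm ⟨k, h⟩ else 0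
  have heK (k : ℕ) : e k ∈ K := by
    simp only [e]
    split_ifs with h
    · exact htK (ht.mem_toFinset.1 (eq.symm ⟨k, h⟩).2)
    · exact h0
  refine ⟨(SimpleFunc.nearestPt e ht.toFinset.card).comp X hX, fun ω => ?_, ?_⟩
  · exact heK _
  · filter_upwards [hXK] with ω hω
    obtain ⟨y, hy, hyb⟩ := Set.mem_iUnion₂.1 (hcov hω)
    have hyt : y ∈ ht.toFinset := ht.mem_toFinset.2 hy
    have hey : e (eq ⟨y, hyt⟩) = y := by simp [e]
    have := SimpleFunc.edist_nearestPt_le e (X ω) (eq ⟨y, hyt⟩).2.le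
    rw [hey, edist_dist, edist_dist, ENNReal.ofReal_le_ofReal_iff dist_nonneg] at this
    rw [← dist_eq_norm]
    exact this.trans (Metric.mem_ball'.1 hyb).le

/-- The functions `φ ∘ s` of a simple function `s`, as elements of `L∞` depending linearly
on `φ`. -/
noncomputable def simpleFuncCompLp {Ω E : Type*} [MeasurableSpace Ω] (μ : Measure Ω)
    (s : SimpleFunc Ω E) : (E → ℝ) →ₗ[ℝ] Lp ℝ ⊤ μ where
  toFun φ := ((s.map φ).memLp_top μ).toLp
  map_add' φ ψ := MemLp.toLp_add ((s.map φ).memLp_top μ) ((s.map ψ).memLp_top μ)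
  map_smul' c φ := MemLp.toLp_const_smul c ((s.map φ).memLp_top μ)

section

variable {Ω Ω' E : Type*} [MeasurableSpace Ω] [MeasurableSpace Ω'] {μ : Measure Ω}
  {μ' : Measure Ω'}

lemma coeFn_simpleFuncCompLp (s : SimpleFunc Ω E) (φ : E → ℝ) :
    simpleFuncCompLp μ s φ =ᵐ[μ] fun ω => φ (s ω) :=
  MemLp.coeFn_toLp ((s.map φ).memLp_top μ)

lemma norm_le_of_ae_norm_le {f : Lp ℝ ⊤ μ} {C : ℝ} (hC : 0 ≤ C) (hf : ∀ᵐ ω ∂μ, ‖f ω‖ ≤ C) :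
    ‖f‖ ≤ C := by
  rw [Lp.norm_def, eLpNorm_exponent_top]
  exact ENNReal.toReal_le_of_le_ofReal hC (eLpNormEssSup_le_of_ae_bound hf)

lemma simpleFuncCompLp_eq_sum [DecidableEq E] (s : SimpleFunc Ω E) (φ : E → ℝ) :
    simpleFuncCompLp μ s φ =
      ∑ a : s.range, φ a • simpleFuncCompLp μ s (Pi.single (a : E) 1) := by
  simp only [← map_smul, ← map_sum]
  refine Lp.ext ((coeFn_simpleFuncCompLp s _).trans
    (Filter.EventuallyEq.trans ?_ (coeFn_simpleFuncCompLp s _).symm))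
  refine Filter.Eventually.of_forall fun ω => ?_
  simp only [Finset.sum_apply, Pi.smul_apply, smul_eq_mul]
  rw [Finset.sum_eq_single ⟨s ω, s.mem_range_self ω⟩]
  · simp
  · intro b _ hb
    rw [Pi.single_eq_of_ne fun h => hb (Subtype.ext h.symm), mul_zero]
  · simp

lemma coeFn_clm_simpleFuncCompLp [DecidableEq E] (T : Lp ℝ ⊤ μ →L[ℝ] Lp ℝ 1 μ')
    (s : SimpleFunc Ω E) (φ : E → ℝ) :
    T (simpleFuncCompLp μ s φ) =ᵐ[μ'] fun ω' => ∑ a : s.range,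
      T (simpleFuncCompLp μ s (Pi.single (a : E) 1)) ω' * φ a := by
  rw [simpleFuncCompLp_eq_sum s φ, map_sum]
  have h1 := Lp.coeFn_finsetSum Finset.univ fun a : s.range =>
    T (φ a • simpleFuncCompLp μ s (Pi.single (a : E) 1))
  have h2 (a : s.range) : T (φ a • simpleFuncCompLp μ s (Pi.single (a : E) 1)) =ᵐ[μ']
      φ a • ⇑(T (simpleFuncCompLp μ s (Pi.single (a : E) 1))) := by
    rw [map_smul]
    exact Lp.coeFn_smul _ _
  filter_upwards [h1, ae_all_iff.2 h2] with ω' h h'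
  rw [h, Finset.sum_apply]
  exact Finset.sum_congr rfl fun a _ => by rw [h' a, Pi.smul_apply, smul_eq_mul, mul_comm]

lemma eLpNorm_simpleFunc_le {n : ℕ} (T : Lp ℝ ⊤ μ →L[ℝ] Lp ℝ 1 μ')
    (s : SimpleFunc Ω (EuclideanSpace ℝ (Fin n))) {M : ℝ} (hM : 0 ≤ M) (hs : ∀ ω, ‖s ω‖ ≤ M) :
    eLpNorm (fun ω' => WithLp.toLp 2 fun j : Fin n =>
        (T (simpleFuncCompLp μ s fun v => v j) : Ω' → ℝ) ω') 1 μ' ≤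
      ENNReal.ofReal (Real.pi / (2 * Real.log (1 + √2)) * ‖T‖ * M) := by
  classical
  set K := Real.pi / (2 * Real.log (1 + √2)) with hK
  have hK0 : 0 ≤ K := by
    have : 0 ≤ Real.log (1 + √2) := Real.log_nonneg (by linarith [Real.sqrt_nonneg 2])
    have := Real.pi_pos
    positivity
  have hsa (a : s.range) : ‖(a : EuclideanSpace ℝ (Fin n))‖ ≤ M := by
    obtain ⟨ω, hω⟩ := SimpleFunc.mem_range.1 a.2
    exact hω ▸ hs ω
  obtain ⟨p, hp0, hp1, hp⟩ := exists_sign_average_bound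
    (fun a : s.range => M⁻¹ • (a : EuclideanSpace ℝ (Fin n))) fun a => by
      rw [norm_smul, norm_inv, Real.norm_of_nonneg hM]
      exact inv_mul_le_one_of_le₀ (hsa a) hM
  let φ : (s.range → SignType) → EuclideanSpace ℝ (Fin n) → ℝ := fun σ v =>
    if h : v ∈ s.range then (σ ⟨v, h⟩ : ℝ) else 0
  have hφ (σ : s.range → SignType) : ‖simpleFuncCompLp μ s (φ σ)‖ ≤ 1 := by
    refine norm_le_of_ae_norm_le zero_le_one ?_
    filter_upwards [coeFn_simpleFuncCompLp s (φ σ)] with ω hω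
    rw [hω]
    simp only [φ, s.mem_range_self, dite_true]
    exact abs_coe_sign_le_one _
  have hae : ∀ᵐ ω' ∂μ', ‖(WithLp.toLp 2 fun j : Fin n =>
        (T (simpleFuncCompLp μ s fun v => v j) : Ω' → ℝ) ω' : EuclideanSpace ℝ (Fin n))‖ ≤
      M * (K * ∑ σ, p σ * ‖T (simpleFuncCompLp μ s (φ σ)) ω'‖) := by
    filter_upwards [ae_all_iff.2 fun j : Fin n => coeFn_clm_simpleFuncCompLp T s fun v => v j,
      ae_all_iff.2 fun σ => coeFn_clm_simpleFuncCompLp T s (φ σ)] with ω' h1 h2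
    have := hp fun a => T (simpleFuncCompLp μ s (Pi.single (a : EuclideanSpace ℝ (Fin n)) 1)) ω'
    simp only [h2, Real.norm_eq_abs]
    have h3 (σ : s.range → SignType) (a : s.range) : φ σ a = σ a := by
      simp only [φ, a.2, dite_true]
    simp only [h3]
    refine le_trans (le_of_eq ?_) (mul_le_mul_of_nonneg_left this hM)
    rw [← Real.norm_of_nonneg hM, ← norm_smul, Real.norm_of_nonneg hM, Finset.smul_sum]
    congr 1
    ext j
    simp only [h1, WithLp.ofLp_sum, Finset.sum_apply, PiLp.smul_apply, smul_eq_mul]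
    refine Finset.sum_congr rfl fun a _ => ?_
    rcases hM.eq_or_lt with h | h
    · have : (a : EuclideanSpace ℝ (Fin n)) = 0 := norm_le_zero_iff.1 (h ▸ hsa a)
      simp [this]
    · field_simp
  have hint (σ : s.range → SignType) :
      Integrable (fun ω' => p σ * ‖T (simpleFuncCompLp μ s (φ σ)) ω'‖) μ' :=
    (L1.integrable_coeFn _).norm.const_mul _
  refine (eLpNorm_mono_ae_real hae).trans ?_
  rw [eLpNorm_one_eq_lintegral_enorm, ← ofReal_integral_norm_eq_lintegral_enorm
    (((integrable_finsetSum _ fun σ _ => hint σ).const_mul _).const_mul _)]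
  refine ENNReal.ofReal_le_ofReal ?_
  have hnn (ω' : Ω') : ‖M * (K * ∑ σ, p σ * ‖T (simpleFuncCompLp μ s (φ σ)) ω'‖)‖ =
      M * (K * ∑ σ, p σ * ‖T (simpleFuncCompLp μ s (φ σ)) ω'‖) :=
    Real.norm_of_nonneg (mul_nonneg hM (mul_nonneg hK0
      (Finset.sum_nonneg fun σ _ => mul_nonneg (hp0 σ) (norm_nonneg _))))
  simp only [hnn]
  rw [integral_const_mul, integral_const_mul, integral_finsetSum _ fun σ _ => hint σ]
  simp only [integral_const_mul, ← L1.norm_eq_integral_norm]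
  have hsum : ∑ σ, p σ * ‖T (simpleFuncCompLp μ s (φ σ))‖ ≤ ‖T‖ := by
    calc _ ≤ ∑ σ, p σ * ‖T‖ := Finset.sum_le_sum fun σ _ =>
          mul_le_mul_of_nonneg_left (T.unit_le_opNorm _ (hφ σ)) (hp0 σ)
      _ = ‖T‖ := by rw [← Finset.sum_mul, hp1, one_mul]
  calc _ ≤ M * (K * ‖T‖) := by gcongr
    _ = _ := by ring

lemma eLpNorm_toLp_le_sum {n : ℕ} (y : Fin n → Lp ℝ 1 μ') :
    eLpNorm (fun ω' => WithLp.toLp 2 fun j : Fin n => (y j : Ω' → ℝ) ω') 1 μ' ≤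
      ENNReal.ofReal (∑ j, ‖y j‖) := by
  have hle (ω' : Ω') : ‖(WithLp.toLp 2 fun j : Fin n => (y j : Ω' → ℝ) ω' :
      EuclideanSpace ℝ (Fin n))‖ ≤ ∑ j, ‖y j ω'‖ := by
    rw [← (EuclideanSpace.basisFun (Fin n) ℝ).sum_repr (WithLp.toLp 2 fun j => (y j : Ω' → ℝ) ω')]
    refine (norm_sum_le _ _).trans (le_of_eq ?_)
    simp [norm_smul]
  refine (eLpNorm_mono_real hle).trans ?_
  have hint (j : Fin n) : Integrable (fun ω' => ‖y j ω'‖) μ' := (L1.integrable_coeFn _).norm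
  rw [eLpNorm_one_eq_lintegral_enorm, ← ofReal_integral_norm_eq_lintegral_enorm
    (integrable_finsetSum _ fun j _ => hint j)]
  refine ENNReal.ofReal_le_ofReal (le_of_eq ?_)
  simp only [L1.norm_eq_integral_norm, ← integral_finsetSum _ fun j _ => hint j]
  refine integral_congr_ae (.of_forall fun ω' => ?_)
  exact Real.norm_of_nonneg (Finset.sum_nonneg fun j _ => norm_nonneg _)

end

end Grothendieck

/-- **Grothendieck's theorem** (Marcinkiewicz–Zygmund style): a bounded operator
`T : L∞(μ) → L¹(μ')` satisfies the square-function inequality with Krivine's constant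
`K = π / (2 · log (1 + √2))`.  The square functions are formed pointwise from
representatives, and the `L¹` and `L∞` norms are expressed via `eLpNorm`. -/
theorem grothendieck_marcinkiewicz_zygmund
    (Ω Ω' : Type*) [MeasurableSpace Ω] [MeasurableSpace Ω']
    (μ : Measure Ω) (μ' : Measure Ω')
    (T : Lp ℝ ⊤ μ →L[ℝ] Lp ℝ 1 μ') (n : ℕ) (x : Fin n → Lp ℝ ⊤ μ) :
    eLpNorm (fun ω' => Real.sqrt (∑ j, ((T (x j) : Ω' → ℝ) ω') ^ 2)) 1 μ'
      ≤ ENNReal.ofReal ((Real.pi / (2 * Real.log (1 + Real.sqrt 2))) * ‖T‖) *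
        eLpNorm (fun ω => Real.sqrt (∑ j, ((x j : Ω → ℝ) ω) ^ 2)) ⊤ μ := by
  have hsqrt (v : Fin n → ℝ) :
      Real.sqrt (∑ j, v j ^ 2) = ‖(WithLp.toLp 2 v : EuclideanSpace ℝ (Fin n))‖ := by
    simp [EuclideanSpace.norm_eq]
  set X : Ω → EuclideanSpace ℝ (Fin n) := fun ω => WithLp.toLp 2 fun j => x j ω with hX
  have hleft := eLpNorm_norm (p := 1) (μ := μ') fun ω' =>
    (WithLp.toLp 2 fun j => T (x j) ω' : EuclideanSpace ℝ (Fin n))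
  have hright := eLpNorm_norm (p := ⊤) (μ := μ) X
  simp only [fun ω' => hsqrt fun j => T (x j) ω', fun ω => hsqrt fun j => x j ω]
  rw [hleft, hright]
  have hXm : Measurable X :=
    (WithLp.measurable_toLp 2 _).comp (measurable_pi_lambda _ fun j =>
      (Lp.stronglyMeasurable (x j)).measurable)
  have hXL : MemLp X ⊤ μ := MemLp.of_eval_piLp fun j => Lp.memLp (x j)
  set M := (eLpNorm X ⊤ μ).toReal with hM
  have hMX : ∀ᵐ ω ∂μ, X ω ∈ Metric.closedBall 0 M := by
    filter_upwards [ae_le_eLpNormEssSup (μ := μ) (f := X)] with ω hω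
    rw [mem_closedBall_zero_iff, hM, eLpNorm_exponent_top, ← toReal_enorm]
    exact ENNReal.toReal_mono (by simpa using hXL.eLpNorm_ne_top) hω
  have hM0 : 0 ≤ M := ENNReal.toReal_nonneg
  rw [← ENNReal.ofReal_toReal hXL.eLpNorm_ne_top, ← ENNReal.ofReal_mul' hM0]
  have key (δ : ℝ) (hδ : 0 < δ) : eLpNorm (fun ω' => WithLp.toLp 2 fun j : Fin n =>
        (T (x j) : Ω' → ℝ) ω') 1 μ' ≤
      ENNReal.ofReal (Real.pi / (2 * Real.log (1 + √2)) * ‖T‖ * M) +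
        ENNReal.ofReal (∑ _j : Fin n, ‖T‖ * δ) := by
    obtain ⟨s, hsM, hsX⟩ := Grothendieck.exists_simpleFunc_norm_sub_le
      (isCompact_closedBall (0 : EuclideanSpace ℝ (Fin n)) M) (by simpa using hM0) hXm hMX hδ
    let y : Fin n → Lp ℝ ⊤ μ := fun j => Grothendieck.simpleFuncCompLp μ s fun v => v j
    have hxy (j : Fin n) : ‖x j - y j‖ ≤ δ := by
      refine Grothendieck.norm_le_of_ae_norm_le hδ.le ?_
      filter_upwards [hsX, Grothendieck.coeFn_simpleFuncCompLp (μ := μ) s fun v => v j,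
        Lp.coeFn_sub (x j) (y j)] with ω h1 h2 h3
      rw [h3, Pi.sub_apply, h2, norm_sub_rev]
      exact (PiLp.norm_apply_le (s ω - X ω) j).trans h1
    have hae : (fun ω' => (WithLp.toLp 2 fun j : Fin n => (T (x j) : Ω' → ℝ) ω' :
          EuclideanSpace ℝ (Fin n))) =ᵐ[μ']
        (fun ω' => WithLp.toLp 2 fun j : Fin n => (T (y j) : Ω' → ℝ) ω') +
          fun ω' => WithLp.toLp 2 fun j : Fin n => (T (x j - y j) : Ω' → ℝ) ω' := by
      have h (j : Fin n) : T (x j - y j) =ᵐ[μ'] ⇑(T (x j)) - ⇑(T (y j)) := by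
        rw [map_sub]
        exact Lp.coeFn_sub _ _
      filter_upwards [ae_all_iff.2 h] with ω' hω'
      ext j
      change T (x j) ω' = T (y j) ω' + T (x j - y j) ω'
      rw [hω' j, Pi.sub_apply, add_sub_cancel]
    have hmeas (z : Fin n → Lp ℝ 1 μ') : AEStronglyMeasurable (fun ω' =>
        (WithLp.toLp 2 fun j : Fin n => (z j : Ω' → ℝ) ω' : EuclideanSpace ℝ (Fin n))) μ' :=
      (MemLp.of_eval_piLp (p := 1) fun j => Lp.memLp (z j)).aestronglyMeasurable
    rw [eLpNorm_congr_ae hae]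
    refine (eLpNorm_add_le (hmeas _) (hmeas _) le_rfl).trans (add_le_add
      (Grothendieck.eLpNorm_simpleFunc_le T s hM0 fun ω => mem_closedBall_zero_iff.1 (hsM ω))
      ((Grothendieck.eLpNorm_toLp_le_sum _).trans (ENNReal.ofReal_le_ofReal
        (Finset.sum_le_sum fun j _ => T.le_of_opNorm_le_of_le le_rfl (hxy j)))))
  have hlim : Filter.Tendsto (fun δ : ℝ =>
      ENNReal.ofReal (Real.pi / (2 * Real.log (1 + √2)) * ‖T‖ * M) +
        ENNReal.ofReal (∑ _j : Fin n, ‖T‖ * δ)) (nhdsWithin 0 (Set.Ioi 0))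
      (nhds (ENNReal.ofReal (Real.pi / (2 * Real.log (1 + √2)) * ‖T‖ * M))) := by
    have : Continuous fun δ : ℝ =>
      ENNReal.ofReal (Real.pi / (2 * Real.log (1 + √2)) * ‖T‖ * M) +
        ENNReal.ofReal (∑ _j : Fin n, ‖T‖ * δ) :=
      continuous_const.add (ENNReal.continuous_ofReal.comp (by fun_prop))
    simpa using (this.tendsto 0).mono_left nhdsWithin_le_nhds
  exact ge_of_tendsto hlim (eventually_mem_nhdsWithin.mono key)
end

section
/- Let n ≥ 1 and let φ be a real n×n matrix such that the Schur multiplier M_φ : M_n(ℝ) → M_n(ℝ), [a_{ij}] ↦ [φ_{ij}·a_{ij}], has norm at most 1 when M_n(ℝ) carries the operator norm of matrices acting on Euclidean ℝⁿ. Then (1/K)·φ belongs to the closed convex hull in ℝ^{n×n} of the set of rank-one sign matrices { (z_i·w_j)_{i,j} : z, w ∈ [-1,1]ⁿ }, where K = π/(2·log(1+√2)). -/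
section

open MeasureTheory ProbabilityTheory Real Set

theorem Real.measurable_sign : Measurable Real.sign := by
  unfold Real.sign
  exact Measurable.ite measurableSet_Iio measurable_const
    (Measurable.ite measurableSet_Ioi measurable_const measurable_const)

theorem Real.abs_sign_le_one (x : ℝ) : |Real.sign x| ≤ 1 := by
  rcases Real.sign_apply_eq x with h | h | h <;> simp [h]

theorem Real.sign_mul_of_pos {r : ℝ} (hr : 0 < r) (x : ℝ) :
    Real.sign (r * x) = Real.sign x := by
  rcases lt_trichotomy x 0 with h | rfl | h
  · rw [Real.sign_of_neg h, Real.sign_of_neg (mul_neg_of_pos_of_neg hr h)]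
  · simp
  · rw [Real.sign_of_pos h, Real.sign_of_pos (mul_pos hr h)]

theorem integral_sign_cos_mul_sign_sin {a : ℝ} (ha : a ∈ Icc (-(π / 2)) (π / 2)) :
    ∫ t in Ioo (-π) π, Real.sign (cos t) * Real.sign (sin (t + a)) = 4 * a := by
  have hπ := Real.pi_pos
  obtain ⟨ha1, ha2⟩ := ha
  set g : ℝ → ℝ := fun t ↦ Real.sign (cos t) * Real.sign (sin (t + a)) with hg
  have hmeas : Measurable g := by
    have := Real.measurable_sign
    fun_prop
  have hint (u v : ℝ) : IntervalIntegrable g volume u v := by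
    refine (intervalIntegrable_const (c := (1 : ℝ))).mono_fun hmeas.aestronglyMeasurable ?_
    refine Filter.Eventually.of_forall fun t ↦ ?_
    simpa [hg, abs_mul] using
      mul_le_one₀ (Real.abs_sign_le_one (cos t)) (abs_nonneg _) (Real.abs_sign_le_one (sin (t + a)))
  have hper : Function.Periodic g π := fun t ↦ by
    simp [hg, cos_add_pi, show t + π + a = t + a + π by ring, sin_add_pi, Real.sign_neg]
  have hneg : ∫ t in (-(π / 2))..(-a), g t = -(π / 2 - a) := by
    have : ∫ t in (-(π / 2))..(-a), g t = ∫ t in (-(π / 2))..(-a), (-1 : ℝ) := by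
      refine intervalIntegral.integral_congr_uIoo fun t ht ↦ ?_
      rw [uIoo_of_le (by linarith)] at ht
      have h1 : 0 < cos t := cos_pos_of_mem_Ioo ⟨ht.1, by linarith [ht.2]⟩
      have h2 : sin (t + a) < 0 := sin_neg_of_neg_of_neg_pi_lt (by linarith [ht.2])
        (by linarith [ht.1])
      simp [hg, Real.sign_of_pos h1, Real.sign_of_neg h2]
    rw [this]; simp; ring
  have hpos : ∫ t in (-a)..(π / 2), g t = π / 2 + a := by
    have : ∫ t in (-a)..(π / 2), g t = ∫ t in (-a)..(π / 2), (1 : ℝ) := by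
      refine intervalIntegral.integral_congr_uIoo fun t ht ↦ ?_
      rw [uIoo_of_le (by linarith)] at ht
      have h1 : 0 < cos t := cos_pos_of_mem_Ioo ⟨by linarith [ht.1], ht.2⟩
      have h2 : 0 < sin (t + a) := sin_pos_of_pos_of_lt_pi (by linarith [ht.1])
        (by linarith [ht.2])
      simp [hg, Real.sign_of_pos h1, Real.sign_of_pos h2]
    rw [this]; simp
  have hhalf : ∫ t in (-(π / 2))..(π / 2), g t = 2 * a := by
    rw [← intervalIntegral.integral_add_adjacent_intervals (hint _ (-a)) (hint _ _), hneg, hpos]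
    ring
  have hshift (s : ℝ) : ∫ t in s..(s + π), g t = 2 * a := by
    rw [hper.intervalIntegral_add_eq s (-(π / 2)), ← hhalf]
    congr 1; ring
  rw [← integral_Ioc_eq_integral_Ioo, ← intervalIntegral.integral_of_le (by linarith),
    ← intervalIntegral.integral_add_adjacent_intervals (hint _ 0) (hint _ _)]
  have h1 := hshift (-π)
  have h2 := hshift 0
  rw [neg_add_cancel] at h1
  rw [zero_add] at h2
  rw [h1, h2]; ring

theorem integral_gaussianReal_prod_eq (f : ℝ × ℝ → ℝ) :
    ∫ p, f p ∂((gaussianReal 0 1).prod (gaussianReal 0 1)) =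
      ∫ p : ℝ × ℝ, ((2 * π)⁻¹ * exp (-(p.1 ^ 2 + p.2 ^ 2) / 2)) * f p := by
  rw [gaussianReal_of_var_ne_zero _ one_ne_zero,
    prod_withDensity (measurable_gaussianPDF _ _) (measurable_gaussianPDF _ _),
    integral_withDensity_eq_integral_toReal_smul (by fun_prop)]
  · rw [Measure.volume_eq_prod]
    refine integral_congr_ae (Filter.Eventually.of_forall fun p ↦ ?_)
    simp only [ENNReal.toReal_mul, toReal_gaussianPDF, smul_eq_mul, gaussianPDFReal]
    rw [show -(p.1 ^ 2 + p.2 ^ 2) / 2 = -p.1 ^ 2 / 2 + -p.2 ^ 2 / 2 by ring, exp_add]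
    have : (√(2 * π))⁻¹ * (√(2 * π))⁻¹ = (2 * π)⁻¹ := by
      rw [← mul_inv, mul_self_sqrt (by positivity)]
    simp only [NNReal.coe_one, mul_one, sub_zero]
    rw [← this]; ring
  · exact Filter.Eventually.of_forall fun p ↦
      ENNReal.mul_lt_top gaussianPDF_lt_top gaussianPDF_lt_top

theorem integral_gaussianReal_prod_of_homogeneous (f : ℝ × ℝ → ℝ) (h : ℝ → ℝ)
    (hf : ∀ r t : ℝ, 0 < r → f (r * cos t, r * sin t) = h t) :
    ∫ p, f p ∂((gaussianReal 0 1).prod (gaussianReal 0 1)) =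
      (∫ r in Ioi (0 : ℝ), r * ((2 * π)⁻¹ * exp (-r ^ 2 / 2))) * ∫ t in Ioo (-π) π, h t := by
  rw [integral_gaussianReal_prod_eq, ← integral_comp_polarCoord_symm,
    ← setIntegral_prod_mul, ← Measure.volume_eq_prod, polarCoord_target]
  refine setIntegral_congr_fun (measurableSet_Ioi.prod measurableSet_Ioo) fun p hp ↦ ?_
  simp only [polarCoord_symm_apply, smul_eq_mul, hf p.1 p.2 hp.1]
  rw [show (p.1 * cos p.2) ^ 2 + (p.1 * sin p.2) ^ 2 = p.1 ^ 2 by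
    rw [mul_pow, mul_pow, ← mul_add, cos_sq_add_sin_sq, mul_one]]
  ring

theorem integral_sign_mul_sign_gaussianReal_prod {a : ℝ} (ha : a ∈ Icc (-(π / 2)) (π / 2)) :
    ∫ p : ℝ × ℝ, Real.sign p.1 * Real.sign (sin a * p.1 + cos a * p.2)
      ∂((gaussianReal 0 1).prod (gaussianReal 0 1)) = 2 / π * a := by
  have hmass := integral_gaussianReal_prod_of_homogeneous (fun _ ↦ 1) (fun _ ↦ 1)
    (fun _ _ _ ↦ rfl)
  have hπ := Real.pi_pos
  simp only [integral_const, probReal_univ, smul_eq_mul, mul_one, MeasurableSet.univ,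
    measureReal_restrict_apply, univ_inter, volume_real_Ioo] at hmass
  rw [max_eq_left (by linarith)] at hmass
  rw [integral_gaussianReal_prod_of_homogeneous _
    (fun t ↦ Real.sign (cos t) * Real.sign (sin (t + a))), integral_sign_cos_mul_sign_sin ha]
  · generalize ∫ r in Ioi (0 : ℝ), r * ((2 * π)⁻¹ * exp (-r ^ 2 / 2)) = R at hmass ⊢
    field_simp
    linear_combination -2 * a * hmass
  · intro r t hr
    simp only
    rw [Real.sign_mul_of_pos hr,
      show sin a * (r * cos t) + cos a * (r * sin t) = r * sin (t + a) by rw [sin_add]; ring,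
      Real.sign_mul_of_pos hr]

theorem map_eval_multivariateGaussian_eq {ι : Type*} [Fintype ι] [DecidableEq ι]
    {B : Matrix ι ι ℝ} (hB : B.PosSemidef) (hdiag : ∀ i, B i i = 1) (i j : ι) {a : ℝ}
    (ha : sin a = B i j) :
    (multivariateGaussian 0 B).map (fun x ↦ (x i, x j)) =
      ((gaussianReal 0 1).prod (gaussianReal 0 1)).map
        (fun p : ℝ × ℝ ↦ (p.1, sin a * p.1 + cos a * p.2)) := by
  refine Measure.ext_of_charFunDual (funext fun L ↦ ?_)
  set s := L (1, 0)
  set t := L (0, 1)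
  have hL (p : ℝ × ℝ) : L p = s * p.1 + t * p.2 := by
    have : p = p.1 • ((1, 0) : ℝ × ℝ) + p.2 • ((0, 1) : ℝ × ℝ) := by ext <;> simp
    conv_lhs => rw [this, map_add, map_smul, map_smul]
    simp only [smul_eq_mul]; ring
  have hji : B j i = B i j := by simpa using hB.1.apply i j
  have hleft : charFunDual ((multivariateGaussian 0 B).map (fun x ↦ (x i, x j))) L =
      Complex.exp (-(s ^ 2 + 2 * sin a * s * t + t ^ 2) / 2) := by
    have h := charFun_multivariateGaussian (μ := 0) hB
      (EuclideanSpace.single i s + EuclideanSpace.single j t)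
    rw [charFunDual_apply, integral_map (by fun_prop) (by fun_prop)]
    rw [charFun_apply] at h
    convert h using 1
    · refine integral_congr_ae (Filter.Eventually.of_forall fun x ↦ ?_)
      simp [hL, inner_add_right, EuclideanSpace.inner_single_right]
    · simp [Matrix.mulVec_add, add_dotProduct, dotProduct_add, hdiag, hji, ha, Matrix.mulVec_single]
      ring_nf
  rw [hleft, charFunDual_apply, integral_map (by fun_prop) (by fun_prop)]
  have hsplit : ∀ p : ℝ × ℝ, Complex.exp (L (p.1, sin a * p.1 + cos a * p.2) * Complex.I) =
      Complex.exp ((s + t * sin a : ℝ) * p.1 * Complex.I) *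
        Complex.exp ((t * cos a : ℝ) * p.2 * Complex.I) := fun p ↦ by
    rw [← Complex.exp_add, hL]
    push_cast
    ring_nf
  simp_rw [hsplit]
  rw [integral_prod_mul (fun x : ℝ ↦ Complex.exp ((s + t * sin a : ℝ) * x * Complex.I))
    (fun x : ℝ ↦ Complex.exp ((t * cos a : ℝ) * x * Complex.I)), ← charFun_apply_real,
    ← charFun_apply_real, charFun_gaussianReal, charFun_gaussianReal, ← Complex.exp_add]
  congr 1
  have : (cos a : ℂ) ^ 2 = 1 - (sin a : ℂ) ^ 2 := by
    exact_mod_cast Real.cos_sq' a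
  push_cast at this ⊢
  linear_combination (t ^ 2 / 2 : ℂ) * this

theorem integral_sign_mul_sign_multivariateGaussian {ι : Type*} [Fintype ι] [DecidableEq ι]
    {B : Matrix ι ι ℝ} (hB : B.PosSemidef) (hdiag : ∀ i, B i i = 1) (i j : ι) {a : ℝ}
    (ha : a ∈ Icc (-(π / 2)) (π / 2)) (hsin : sin a = B i j) :
    ∫ x, Real.sign (x i) * Real.sign (x j) ∂(multivariateGaussian 0 B) = 2 / π * a := by
  have hs := Real.measurable_sign
  have hmeas : Measurable fun p : ℝ × ℝ ↦ Real.sign p.1 * Real.sign p.2 := by fun_prop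
  have h := congrArg (fun ν ↦ ∫ p, Real.sign p.1 * Real.sign p.2 ∂ν)
    (map_eval_multivariateGaussian_eq hB hdiag i j hsin)
  simp only at h
  rw [integral_map (by fun_prop) hmeas.aestronglyMeasurable,
    integral_map (by fun_prop) hmeas.aestronglyMeasurable] at h
  rw [h, integral_sign_mul_sign_gaussianReal_prod ha]

namespace Matrix

theorem PosSemidef.of_hasSum {ι α : Type*} [Fintype ι] {A : α → Matrix ι ι ℝ}
    {B : Matrix ι ι ℝ} (hA : ∀ k, (A k).PosSemidef)
    (h : ∀ i j, HasSum (fun k ↦ A k i j) (B i j)) : B.PosSemidef := by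
  refine PosSemidef.of_dotProduct_mulVec_nonneg (IsHermitian.ext fun i j ↦ ?_) fun x ↦ ?_
  · refine (h j i).unique ?_
    convert h i j using 2 with k
    simpa using (hA k).1.apply i j
  · have hs : HasSum (fun k ↦ ∑ i, x i * ∑ j, A k i j * x j) (∑ i, x i * ∑ j, B i j * x j) :=
      hasSum_sum fun i _ ↦ (hasSum_sum fun j _ ↦ (h i j).mul_right (x j)).mul_left (x i)
    refine hs.nonneg fun k ↦ ?_
    simpa [dotProduct, mulVec] using (hA k).dotProduct_mulVec_nonneg x

theorem PosSemidef.map_pow {ι : Type*} {A : Matrix ι ι ℝ} (hA : A.PosSemidef) (k : ℕ) :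
    (A.map (· ^ (k + 1))).PosSemidef := by
  induction k with
  | zero => simpa using hA
  | succ k ih =>
    have h : A.map (· ^ (k + 1 + 1)) = (A.map (· ^ (k + 1))).hadamard A := by
      ext i j
      simp [pow_succ]
    rw [h]
    exact ih.hadamard hA

theorem PosSemidef.abs_apply_le_one {ι : Type*} [Fintype ι] [DecidableEq ι] {A : Matrix ι ι ℝ}
    (hA : A.PosSemidef) (hdiag : ∀ i, A i i ≤ 1) (i j : ι) : |A i j| ≤ 1 := by
  have hji : A j i = A i j := by simpa using hA.1.apply i j
  have h1 := hA.dotProduct_mulVec_nonneg (Pi.single i 1 + Pi.single j 1)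
  have h2 := hA.dotProduct_mulVec_nonneg (Pi.single i 1 - Pi.single j 1)
  simp [mulVec_add, mulVec_sub, add_dotProduct, sub_dotProduct, dotProduct_add, dotProduct_sub,
    mulVec_single, hji] at h1 h2
  have := hdiag i
  have := hdiag j
  rw [abs_le]
  constructor <;> linarith

theorem PosSemidef.exists_krivine {ι κ : Type*} [Fintype ι] [Fintype κ]
    [DecidableEq ι] [DecidableEq κ] {A : Matrix (ι ⊕ κ) (ι ⊕ κ) ℝ} (hA : A.PosSemidef)
    (hdiag : ∀ i, A i i ≤ 1) {c : ℝ} (hc : 0 ≤ c) (hc1 : sinh c = 1) :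
    ∃ B : Matrix (ι ⊕ κ) (ι ⊕ κ) ℝ, B.PosSemidef ∧ (∀ i, B i i = 1) ∧
      ∀ i j, B (.inl i) (.inr j) = sin (c * A (.inl i) (.inr j)) := by
  let e : ℕ → ι ⊕ κ → ℝ := fun k ↦ Sum.elim 1 fun _ ↦ (-1) ^ k
  let T : ℕ → Matrix (ι ⊕ κ) (ι ⊕ κ) ℝ := fun k ↦
    (c ^ (2 * k + 1) / (2 * k + 1).factorial) • (diagonal (e k) * A.map (· ^ (2 * k + 1)) *
      (diagonal (e k))ᴴ)
  have hT (k) : (T k).PosSemidef :=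
    ((hA.map_pow (2 * k)).mul_mul_conjTranspose_same _).smul (by positivity)
  have hTapply (k i j) : T k i j = e k i * e k j *
      ((c * A i j) ^ (2 * k + 1) / (2 * k + 1).factorial) := by
    simp [T, mul_pow]
    ring
  have he (k) : ((-1 : ℝ) ^ k) * (-1) ^ k = 1 := by rw [← mul_pow]; simp
  let C : Matrix (ι ⊕ κ) (ι ⊕ κ) ℝ := of fun i j ↦
    match i, j with
    | .inl _, .inl _ => sinh (c * A i j)
    | .inr _, .inr _ => sinh (c * A i j)
    | .inl _, .inr _ => sin (c * A i j)
    | .inr _, .inl _ => sin (c * A i j)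
  have hC : C.PosSemidef := by
    refine .of_hasSum hT fun i j ↦ ?_
    simp_rw [hTapply]
    rcases i with i | i <;> rcases j with j | j
    · simpa [e, C] using Real.hasSum_sinh (c * A (.inl i) (.inl j))
    · simpa [e, C, mul_div_assoc] using Real.hasSum_sin (c * A (.inl i) (.inr j))
    · simpa [e, C, mul_div_assoc] using Real.hasSum_sin (c * A (.inr i) (.inl j))
    · simpa [e, C, he] using Real.hasSum_sinh (c * A (.inr i) (.inr j))
  have hCdiag (i) : C i i ≤ 1 := by
    have : C i i = sinh (c * A i i) := by rcases i with i | i <;> rfl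
    rw [this, ← hc1, sinh_le_sinh]
    exact mul_le_of_le_one_right hc (hdiag i)
  refine ⟨C + diagonal fun i ↦ 1 - C i i, hC.add (.diagonal fun i ↦ ?_), fun i ↦ ?_,
    fun i j ↦ ?_⟩
  · simpa using hCdiag i
  · simp
  · simp [C]

theorem norm_toEuclideanCLM_le_two {ι : Type*} [Fintype ι] [DecidableEq ι] {a : Matrix ι ι ℝ}
    (h : ∀ x y : ι → ℝ, 0 ≤ x ⬝ᵥ x + y ⬝ᵥ y + x ⬝ᵥ a *ᵥ y) :
    ‖toEuclideanCLM (𝕜 := ℝ) a‖ ≤ 2 := by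
  refine ContinuousLinearMap.opNorm_le_bound _ zero_le_two fun y ↦ ?_
  have hxy := h (-(1 / 2 : ℝ) • (a *ᵥ y)) y
  have hw : ‖toEuclideanCLM (𝕜 := ℝ) a y‖ ^ 2 = (a *ᵥ y) ⬝ᵥ (a *ᵥ y) := by
    simp [EuclideanSpace.real_norm_sq_eq, dotProduct, ← sq]
  have hy : ‖y‖ ^ 2 = (y : ι → ℝ) ⬝ᵥ (y : ι → ℝ) := by
    simp [EuclideanSpace.real_norm_sq_eq, dotProduct, ← sq]
  simp only [smul_dotProduct, dotProduct_smul, smul_eq_mul, ← hw, ← hy] at hxy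
  refine le_of_sq_le_sq ?_ (by positivity)
  linarith

theorem dotProduct_mulVec_ge_of_norm_toEuclideanCLM_le_two {ι : Type*} [Fintype ι]
    [DecidableEq ι] {a : Matrix ι ι ℝ} (h : ‖toEuclideanCLM (𝕜 := ℝ) a‖ ≤ 2) (x y : ι → ℝ) :
    0 ≤ x ⬝ᵥ x + y ⬝ᵥ y + x ⬝ᵥ a *ᵥ y := by
  set X : EuclideanSpace ℝ ι := WithLp.toLp 2 x
  set Y : EuclideanSpace ℝ ι := WithLp.toLp 2 y
  have hX : ‖X‖ ^ 2 = x ⬝ᵥ x := by simp [X, EuclideanSpace.real_norm_sq_eq, dotProduct, ← sq]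
  have hY : ‖Y‖ ^ 2 = y ⬝ᵥ y := by simp [Y, EuclideanSpace.real_norm_sq_eq, dotProduct, ← sq]
  have hXY : inner ℝ X (toEuclideanCLM (𝕜 := ℝ) a Y) = x ⬝ᵥ a *ᵥ y := by
    simp [X, Y, PiLp.inner_apply, dotProduct, mul_comm]
  have h1 := neg_le_of_abs_le (abs_real_inner_le_norm X (toEuclideanCLM (𝕜 := ℝ) a Y))
  have h2 : ‖toEuclideanCLM (𝕜 := ℝ) a Y‖ ≤ 2 * ‖Y‖ :=
    (ContinuousLinearMap.le_opNorm _ _).trans (by gcongr)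
  have h3 := mul_le_mul_of_nonneg_left h2 (norm_nonneg X)
  rw [hXY] at h1
  nlinarith [sq_nonneg (‖X‖ - ‖Y‖)]

/-- The cone of pairs consisting of the diagonal and the off-diagonal block of a positive
semidefinite block matrix. -/
def diagBlockCone (ι : Type*) : PointedCone ℝ ((ι ⊕ ι → ℝ) × (ι → ι → ℝ)) where
  carrier := {p | ∃ A : Matrix (ι ⊕ ι) (ι ⊕ ι) ℝ, A.PosSemidef ∧ (∀ t, A t t = p.1 t) ∧
    ∀ i j, A (.inl i) (.inr j) = p.2 i j}
  add_mem' := by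
    rintro p q ⟨A, hA, hA1, hA2⟩ ⟨B, hB, hB1, hB2⟩
    exact ⟨A + B, hA.add hB, by simp [hA1, hB1], by simp [hA2, hB2]⟩
  zero_mem' := ⟨0, .zero, by simp, by simp⟩
  smul_mem' := by
    rintro c p ⟨A, hA, hA1, hA2⟩
    exact ⟨c.1 • A, hA.smul c.2, fun t ↦ congrArg (c.1 * ·) (hA1 t),
      fun i j ↦ congrArg (c.1 * ·) (hA2 i j)⟩

theorem one_mem_closure_diagBlockCone {ι : Type*} [Fintype ι] [DecidableEq ι]
    {φ : Matrix ι ι ℝ}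
    (hφ : ∀ a : Matrix ι ι ℝ, ‖toEuclideanCLM (𝕜 := ℝ) (of fun i j ↦ φ i j * a i j)‖
        ≤ ‖toEuclideanCLM (𝕜 := ℝ) a‖) :
    ((fun _ ↦ 1, φ) : (ι ⊕ ι → ℝ) × (ι → ι → ℝ)) ∈
      closure (diagBlockCone ι : Set ((ι ⊕ ι → ℝ) × (ι → ι → ℝ))) := by
  by_contra hnot
  obtain ⟨f, hf, hfφ⟩ := ProperCone.hyperplane_separation_point
    (Submodule.closure (diagBlockCone ι)) (x₀ := ((fun _ ↦ 1, φ) : (ι ⊕ ι → ℝ) × (ι → ι → ℝ)))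
    (by rwa [← SetLike.mem_coe, Submodule.coe_closure])
  let α : ι ⊕ ι → ℝ := fun t ↦ f (Pi.single t 1, 0)
  let c : ι → ι → ℝ := fun i j ↦ f (0, Pi.single i (Pi.single j 1))
  have hfapply (p) : f p = ∑ t, p.1 t * α t + ∑ i, ∑ j, p.2 i j * c i j := by
    have hp : p = ∑ t, p.1 t • ((Pi.single t 1, 0) : (ι ⊕ ι → ℝ) × (ι → ι → ℝ)) +
        ∑ i, ∑ j, p.2 i j • ((0, Pi.single i (Pi.single j 1)) :
          (ι ⊕ ι → ℝ) × (ι → ι → ℝ)) := by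
      ext
      · simp [Prod.fst_sum, Finset.sum_apply, Pi.single_apply, -Fintype.sum_sum_type]
      · simp [Prod.snd_sum, Finset.sum_apply, Pi.single_apply]
    conv_lhs => rw [hp]
    simp only [map_add, map_sum, map_smul, smul_eq_mul, α, c]
  have hquad (v : ι ⊕ ι → ℝ) :
      0 ≤ ∑ t, v t ^ 2 * α t + ∑ i, ∑ j, v (.inl i) * v (.inr j) * c i j := by
    have := hf (fun t ↦ v t ^ 2, fun i j ↦ v (.inl i) * v (.inr j)) (subset_closure
      ⟨vecMulVec v (star v), posSemidef_vecMulVec_self_star v, by simp [vecMulVec_apply, sq],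
        by simp [vecMulVec_apply]⟩)
    rwa [hfapply] at this
  have hα (t) : 0 ≤ α t := by
    have := hquad (Pi.single t 1)
    rcases t with t | t <;> simpa [Pi.single_apply, ite_pow] using this
  rw [hfapply] at hfφ
  simp only [one_mul] at hfφ
  obtain ⟨ε, hε, hεφ⟩ : ∃ ε > 0, ∑ t, (α t + ε) + ∑ i, ∑ j, φ i j * c i j < 0 := by
    set S := ∑ t, α t + ∑ i, ∑ j, φ i j * c i j with hS
    set N : ℝ := (Fintype.card (ι ⊕ ι) : ℝ) with hN
    have hN0 : 0 ≤ N := by positivity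
    refine ⟨-S / (N + 1), div_pos (by linarith) (by linarith), ?_⟩
    rw [Finset.sum_add_distrib, Finset.sum_const, Finset.card_univ, nsmul_eq_mul, ← hN]
    have : N * (-S / (N + 1)) < -S := by
      rw [mul_div_assoc', div_lt_iff₀ (by linarith)]
      nlinarith
    linarith
  let d : ι ⊕ ι → ℝ := fun t ↦ √(α t + ε)
  have hd (t) : 0 < d t := sqrt_pos.2 (by linarith [hα t])
  have hd2 (t) : d t ^ 2 = α t + ε := sq_sqrt (by linarith [hα t])
  let a : Matrix ι ι ℝ := of fun i j ↦ c i j / (d (.inl i) * d (.inr j))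
  have ha : ‖toEuclideanCLM (𝕜 := ℝ) a‖ ≤ 2 := by
    refine norm_toEuclideanCLM_le_two fun x y ↦ ?_
    refine (hquad fun t ↦ Sum.elim x y t / d t).trans ?_
    rw [Fintype.sum_sum_type]
    refine add_le_add (add_le_add ?_ ?_) (le_of_eq ?_)
    · refine Finset.sum_le_sum fun i _ ↦ ?_
      rw [Sum.elim_inl, div_pow, div_mul_eq_mul_div, div_le_iff₀ (pow_pos (hd _) 2), hd2, ← sq]
      exact mul_le_mul_of_nonneg_left (by linarith) (sq_nonneg _)
    · refine Finset.sum_le_sum fun i _ ↦ ?_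
      rw [Sum.elim_inr, div_pow, div_mul_eq_mul_div, div_le_iff₀ (pow_pos (hd _) 2), hd2, ← sq]
      exact mul_le_mul_of_nonneg_left (by linarith) (sq_nonneg _)
    · simp only [dotProduct, mulVec, Finset.mul_sum, Sum.elim_inl, Sum.elim_inr, a, of_apply]
      refine Finset.sum_congr rfl fun i _ ↦ Finset.sum_congr rfl fun j _ ↦ ?_
      ring
  have hfin := dotProduct_mulVec_ge_of_norm_toEuclideanCLM_le_two ((hφ a).trans ha)
    (fun i ↦ d (.inl i)) (fun j ↦ d (.inr j))
  refine absurd hfin (not_le.2 (lt_of_eq_of_lt ?_ hεφ))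
  rw [Fintype.sum_sum_type]
  refine congrArg₂ _ (congrArg₂ _ ?_ ?_) ?_
  · simp [dotProduct, ← sq, hd2]
  · simp [dotProduct, ← sq, hd2]
  · simp only [dotProduct, mulVec, Finset.mul_sum, a, of_apply]
    refine Finset.sum_congr rfl fun i _ ↦ Finset.sum_congr rfl fun j _ ↦ ?_
    have := (hd (.inl i)).ne'
    have := (hd (.inr j)).ne'
    field_simp

end Matrix

/-- The rank-one matrices `(z i * w j)` with `z` and `w` in the unit cube. -/
def rankOneCube (ι κ : Type*) : Set (ι → κ → ℝ) :=
  {m | ∃ (z : ι → ℝ) (w : κ → ℝ), (∀ i, z i ∈ Icc (-1 : ℝ) 1) ∧ (∀ j, w j ∈ Icc (-1 : ℝ) 1) ∧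
    ∀ i j, m i j = z i * w j}

theorem arcsin_mem_closure_convexHull {ι κ : Type*} [Fintype ι] [Fintype κ]
    [DecidableEq ι] [DecidableEq κ] {B : Matrix (ι ⊕ κ) (ι ⊕ κ) ℝ} (hB : B.PosSemidef)
    (hdiag : ∀ t, B t t = 1) {m : ι → κ → ℝ} (hm : ∀ i j, m i j ∈ Icc (-(π / 2)) (π / 2))
    (hsin : ∀ i j, sin (m i j) = B (.inl i) (.inr j)) :
    (2 / π) • m ∈ closure (convexHull ℝ (rankOneCube ι κ)) := by
  let F : EuclideanSpace ℝ (ι ⊕ κ) → ι → κ → ℝ := fun x i j ↦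
    Real.sign (x (.inl i)) * Real.sign (x (.inr j))
  have hF (x) : F x ∈ rankOneCube ι κ :=
    ⟨fun i ↦ Real.sign (x (.inl i)), fun j ↦ Real.sign (x (.inr j)),
      fun i ↦ abs_le.1 (Real.abs_sign_le_one _), fun j ↦ abs_le.1 (Real.abs_sign_le_one _),
      fun _ _ ↦ rfl⟩
  have hs := Real.measurable_sign
  have hint2 (i j) : Integrable (fun x ↦ F x i j) (multivariateGaussian 0 B) := by
    refine Integrable.of_bound (C := 1) (Measurable.aestronglyMeasurable (by fun_prop))
      (Filter.Eventually.of_forall fun x ↦ ?_)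
    simpa [F, abs_mul] using mul_le_one₀ (Real.abs_sign_le_one (x (.inl i))) (abs_nonneg _)
      (Real.abs_sign_le_one (x (.inr j)))
  have hint1 (i) : Integrable (fun x ↦ F x i) (multivariateGaussian 0 B) :=
    Integrable.of_eval fun j ↦ hint2 i j
  have hint : Integrable F (multivariateGaussian 0 B) := Integrable.of_eval hint1
  have hmem : ∫ x, F x ∂(multivariateGaussian 0 B) ∈ closure (convexHull ℝ (rankOneCube ι κ)) :=
    (convex_convexHull ℝ _).closure.integral_mem isClosed_closure
      (Filter.Eventually.of_forall fun x ↦ subset_closure (subset_convexHull ℝ _ (hF x))) hint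
  convert hmem using 1
  ext i j
  rw [eval_integral hint1, eval_integral (hint2 i)]
  exact (integral_sign_mul_sign_multivariateGaussian hB hdiag _ _ (hm i j) (hsin i j)).symm

theorem smul_mem_closure_convexHull_of_posSemidef {ι κ : Type*} [Fintype ι] [Fintype κ]
    [DecidableEq ι] [DecidableEq κ] {A : Matrix (ι ⊕ κ) (ι ⊕ κ) ℝ} (hA : A.PosSemidef)
    (hdiag : ∀ t, A t t ≤ 1) :
    (1 / (π / (2 * log (1 + √2)))) • (fun i j ↦ A (.inl i) (.inr j)) ∈
      closure (convexHull ℝ (rankOneCube ι κ)) := by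
  have hc : log (1 + √2) = arsinh 1 := by simp [arsinh, one_add_one_eq_two]
  rw [hc]
  have hc0 : 0 ≤ arsinh 1 := arsinh_nonneg_iff.2 zero_le_one
  have hc1 : arsinh 1 ≤ π / 2 := by
    have : arsinh 1 ≤ sinh (arsinh 1) := self_le_sinh_iff.2 hc0
    rw [sinh_arsinh] at this
    linarith [pi_gt_three]
  obtain ⟨B, hB, hB1, hBsin⟩ := hA.exists_krivine hdiag hc0 (sinh_arsinh 1)
  have h := arcsin_mem_closure_convexHull hB hB1
    (m := fun i j ↦ arsinh 1 * A (.inl i) (.inr j)) (fun i j ↦ ?_) (fun i j ↦ (hBsin i j).symm)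
  · convert h using 1
    ext i j
    simp only [Pi.smul_apply, smul_eq_mul, one_div, inv_div]
    ring
  · refine abs_le.1 ?_
    rw [abs_mul, abs_of_nonneg hc0]
    exact (mul_le_of_le_one_right hc0 (hA.abs_apply_le_one hdiag _ _)).trans hc1

theorem smul_mem_closure_convexHull_of_schur_contractive {ι : Type*} [Fintype ι] [DecidableEq ι]
    [Nonempty ι] {φ : Matrix ι ι ℝ}
    (hφ : ∀ a : Matrix ι ι ℝ,
      ‖Matrix.toEuclideanCLM (𝕜 := ℝ) (Matrix.of fun i j ↦ φ i j * a i j)‖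
        ≤ ‖Matrix.toEuclideanCLM (𝕜 := ℝ) a‖) :
    (1 / (π / (2 * log (1 + √2)))) • (φ : ι → ι → ℝ) ∈
      closure (convexHull ℝ (rankOneCube ι ι)) := by
  set K := π / (2 * log (1 + √2))
  have hcont : ContinuousWithinAt
      (fun p : (ι ⊕ ι → ℝ) × (ι → ι → ℝ) ↦ (1 / K) • ‖p.1‖⁻¹ • p.2)
      (Matrix.diagBlockCone ι : Set ((ι ⊕ ι → ℝ) × (ι → ι → ℝ))) (fun _ ↦ 1, φ) := by
    refine ContinuousAt.continuousWithinAt ?_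
    have hnorm : ContinuousAt (fun p : (ι ⊕ ι → ℝ) × (ι → ι → ℝ) ↦ ‖p.1‖⁻¹) (fun _ ↦ 1, φ) :=
      ContinuousAt.inv₀ (by fun_prop) (by simp)
    exact (hnorm.smul continuous_snd.continuousAt).const_smul (1 / K)
  have h := hcont.mem_closure (Matrix.one_mem_closure_diagBlockCone hφ)
    (t := closure (convexHull ℝ (rankOneCube ι ι))) ?_
  · have hone : ‖(fun _ : ι ⊕ ι ↦ (1 : ℝ))‖⁻¹ • (φ : ι → ι → ℝ) = φ := by
      rw [pi_norm_const, norm_one, inv_one, one_smul]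
    rw [closure_closure] at h
    rwa [← hone]
  rintro ⟨d, m⟩ ⟨A, hA, hA1, hA2⟩
  have hA' : (‖d‖⁻¹ • A).PosSemidef := hA.smul (by positivity)
  convert smul_mem_closure_convexHull_of_posSemidef hA' fun t ↦ ?_ using 2
  · ext i j
    simp [hA2]
  · rw [Matrix.smul_apply, hA1, smul_eq_mul, inv_mul_eq_div]
    exact div_le_one_of_le₀ ((le_abs_self _).trans (norm_le_pi_norm d t)) (norm_nonneg _)

end

/-- **Grothendieck's theorem in Schur-multiplier form** (real case): if the Schur multiplier
`M_φ : [a i j] ↦ [φ i j · a i j]` has norm at most `1` on `M_n(ℝ)` with the operator norm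
of matrices acting on Euclidean `ℝⁿ`, then `(1/K)·φ` lies in the closed convex hull of the
rank-one sign matrices `(z i · w j)` with `z, w ∈ [-1,1]ⁿ`, where
`K = π / (2 · log (1 + √2))` is Krivine's constant. -/
theorem schur_multiplier_grothendieck
    (n : ℕ) (hn : 1 ≤ n) (φ : Matrix (Fin n) (Fin n) ℝ)
    (hφ : ∀ a : Matrix (Fin n) (Fin n) ℝ,
      ‖Matrix.toEuclideanCLM (𝕜 := ℝ) (Matrix.of fun i j => φ i j * a i j)‖
        ≤ ‖Matrix.toEuclideanCLM (𝕜 := ℝ) a‖) :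
    (1 / (Real.pi / (2 * Real.log (1 + Real.sqrt 2)))) • φ ∈
      closure (convexHull ℝ
        {m : Matrix (Fin n) (Fin n) ℝ | ∃ z w : Fin n → ℝ,
          (∀ i, z i ∈ Set.Icc (-1 : ℝ) 1) ∧ (∀ j, w j ∈ Set.Icc (-1 : ℝ) 1) ∧
          ∀ i j, m i j = z i * w j}) := by
  have : Nonempty (Fin n) := ⟨⟨0, hn⟩⟩
  exact smul_mem_closure_convexHull_of_schur_contractive hφ
end

section
/- Let A₁ and A₂ be unital C*-algebras and let u : A₁ → A₂ be a bounded linear map. Then for every n and all x_1, …, x_n ∈ A₁: max(‖∑_j (u x_j)*(u x_j)‖^{1/2}, ‖∑_j (u x_j)(u x_j)*‖^{1/2}) ≤ √2·‖u‖·max(‖∑_j x_j*x_j‖^{1/2}, ‖∑_j x_jx_j*‖^{1/2}). -/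
open scoped ComplexOrder InnerProductSpace ComplexStarModule

section States

variable {A : Type*} [CStarAlgebra A]

lemma IsSelfAdjoint.norm_add_I_smul_one_sq_le [NormOneClass A] {h : A} (hh : IsSelfAdjoint h)
    (t : ℝ) : ‖h + (t * Complex.I) • (1 : A)‖ ^ 2 ≤ ‖h‖ ^ 2 + t ^ 2 := by
  have key : star (h + (t * Complex.I) • (1 : A)) * (h + (t * Complex.I) • (1 : A))
      = h * h + ((t : ℂ) ^ 2) • (1 : A) := by
    have hI : (t * Complex.I) * (t * Complex.I) = -(t : ℂ) ^ 2 := by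
      linear_combination (t : ℂ) ^ 2 * Complex.I_mul_I
    simp only [star_add, star_smul, star_one, hh.star_eq, Complex.star_def, map_mul,
      Complex.conj_ofReal, Complex.conj_I, add_mul, mul_add, smul_mul_assoc, mul_smul_comm,
      one_mul, mul_one, smul_add, smul_neg, smul_smul, mul_neg, neg_mul, neg_smul, hI, neg_neg]
    abel
  rw [sq, ← CStarRing.norm_star_mul_self, key]
  refine (norm_add_le _ _).trans (add_le_add ?_ ?_)
  · exact (norm_mul_le _ _).trans (sq _).ge
  · simp [norm_smul]

lemma StrongDual.im_apply_eq_zero_of_isSelfAdjoint [NormOneClass A] {φ : StrongDual ℂ A}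
    (hφ : ‖φ‖ ≤ 1) (hφ1 : φ 1 = 1) {h : A} (hh : IsSelfAdjoint h) : (φ h).im = 0 := by
  have key (t : ℝ) : (φ h).re ^ 2 + ((φ h).im + t) ^ 2 ≤ ‖h‖ ^ 2 + t ^ 2 := by
    have h1 : ‖φ (h + (t * Complex.I) • (1 : A))‖ ≤ ‖h + (t * Complex.I) • (1 : A)‖ :=
      (φ.le_of_opNorm_le hφ _).trans (one_mul _).le
    have h2 := (pow_le_pow_left₀ (norm_nonneg _) h1 2).trans (hh.norm_add_I_smul_one_sq_le t)
    rw [Complex.sq_norm, Complex.normSq_apply] at h2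
    simp [hφ1] at h2
    linarith
  by_contra hne
  have h1 := key ((‖h‖ ^ 2 + 1) / (2 * (φ h).im))
  have h2 : (φ h).im * ((‖h‖ ^ 2 + 1) / (2 * (φ h).im)) = (‖h‖ ^ 2 + 1) / 2 := by
    field_simp
  nlinarith [sq_nonneg (φ h).re, sq_nonneg (φ h).im]

variable [PartialOrder A] [StarOrderedRing A]

lemma StrongDual.apply_nonneg_of_norm_le_one [NormOneClass A] {φ : StrongDual ℂ A}
    (hφ : ‖φ‖ ≤ 1) (hφ1 : φ 1 = 1) {a : A} (ha : 0 ≤ a) : 0 ≤ φ a := by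
  have hle : a ≤ algebraMap ℝ A ‖a‖ := ha.isSelfAdjoint.le_algebraMap_norm_self
  have h1 : ‖algebraMap ℝ A ‖a‖ - a‖ ≤ ‖a‖ := by
    refine (CStarAlgebra.norm_le_norm_of_nonneg_of_le (sub_nonneg.2 hle)
      (sub_le_self _ ha)).trans ?_
    simp
  have h2 : ‖φ (algebraMap ℝ A ‖a‖ - a)‖ ≤ ‖a‖ := by
    simpa using (φ.le_of_opNorm_le hφ _).trans ((one_mul _).le.trans h1)
  have h3 : φ (algebraMap ℝ A ‖a‖) = ‖a‖ := by
    rw [Algebra.algebraMap_eq_smul_one, ← Complex.coe_smul, map_smul, hφ1]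
    simp
  have h4 := (Complex.re_le_norm _).trans h2
  rw [map_sub, h3] at h4
  simp at h4
  rw [Complex.le_def]
  simp [h4, StrongDual.im_apply_eq_zero_of_isSelfAdjoint hφ hφ1 ha.isSelfAdjoint]

lemma CStarAlgebra.norm_one_add_of_nonneg [Nontrivial A] {b : A} (hb : 0 ≤ b) :
    ‖1 + b‖ = 1 + ‖b‖ := by
  refine le_antisymm ((norm_add_le _ _).trans (by simp)) ?_
  have h1 : ‖b‖ + 1 ∈ spectrum ℝ (algebraMap ℝ A 1 + b) :=
    spectrum.add_mem_add_iff.2 (CStarAlgebra.norm_mem_spectrum_of_nonneg hb)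
  have h2 := spectrum.norm_le_norm_of_mem h1
  rw [map_one, Real.norm_of_nonneg (by positivity)] at h2
  linarith

/-- The norm of a positive element of a C⋆-algebra is attained by a state. -/
lemma CStarAlgebra.exists_state_apply_eq_norm [Nontrivial A] {b : A} (hb : 0 ≤ b) :
    ∃ f : A →ₚ[ℂ] ℂ, (∀ a, ‖f a‖ ≤ ‖a‖) ∧ f b = ‖b‖ := by
  obtain ⟨φ, hφ, hφb⟩ := exists_dual_vector'' ℂ (1 + b)
  rw [CStarAlgebra.norm_one_add_of_nonneg hb, map_add] at hφb
  have hle (a : A) : ‖φ a‖ ≤ ‖a‖ := by simpa using φ.le_of_opNorm_le hφ a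
  have h1 : ‖φ 1‖ ≤ 1 := by simpa using hle 1
  have hre : (φ 1).re + (φ b).re = 1 + ‖b‖ := by simpa using congrArg Complex.re hφb
  have h1re : (φ 1).re = 1 := by
    linarith [(Complex.re_le_norm _).trans h1, (Complex.re_le_norm _).trans (hle b)]
  have hφ1 : φ 1 = 1 := by
    refine Complex.ext h1re ?_
    have := pow_le_pow_left₀ (norm_nonneg _) h1 2
    rw [Complex.sq_norm, Complex.normSq_apply, h1re] at this
    simp only [Complex.one_im]
    nlinarith
  refine ⟨PositiveLinearMap.mk₀ φ.toLinearMap fun a ha ↦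
    StrongDual.apply_nonneg_of_norm_le_one hφ hφ1 ha, hle, ?_⟩
  have : φ b = ‖b‖ := by
    rw [hφ1] at hφb
    push_cast at hφb
    linear_combination hφb
  exact this

end States

section LittleGrothendieck

variable {A : Type*} [CStarAlgebra A]

section Ordered

variable [PartialOrder A] [StarOrderedRing A]

lemma CStarAlgebra.norm_one_sub_sqrt_one_sub_sq_le {k : A} (hk : IsSelfAdjoint k)
    (hk1 : ‖k‖ ≤ 1) : ‖1 - CFC.sqrt (1 - k ^ 2)‖ ≤ ‖k‖ ^ 2 := by
  obtain _ | _ := subsingleton_or_nontrivial A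
  · simp [Subsingleton.elim (1 - CFC.sqrt (1 - k ^ 2)) 0]
  have hk2 : 0 ≤ k ^ 2 := by simpa [sq, hk.star_eq] using star_mul_self_nonneg k
  have hn : ‖k ^ 2‖ = ‖k‖ ^ 2 := by rw [sq, hk.norm_mul_self]
  have hk3 : 0 ≤ 1 - k ^ 2 := by
    rw [sub_nonneg, ← CStarAlgebra.norm_le_one_iff_of_nonneg (k ^ 2), hn]
    exact pow_le_one₀ (norm_nonneg _) hk1
  have hs0 := CFC.sqrt_nonneg (1 - k ^ 2)
  have hss := CFC.sq_sqrt (1 - k ^ 2)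
  set s := CFC.sqrt (1 - k ^ 2)
  have hs1 : s ≤ 1 := by
    rw [← CStarAlgebra.norm_le_one_iff_of_nonneg s, ← sq_le_one_iff₀ (norm_nonneg _),
      ← hs0.isSelfAdjoint.norm_mul_self, ← sq, hss, CStarAlgebra.norm_le_one_iff_of_nonneg _]
    exact sub_le_self _ hk2
  rw [← hn]
  refine CStarAlgebra.norm_le_norm_of_nonneg_of_le (sub_nonneg.2 hs1) ?_
  have := CStarAlgebra.pow_antitone hs0 hs1 one_le_two
  simp only [pow_one, hss] at this
  rw [sub_le_comm]
  exact this

end Ordered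

variable {H : Type*} [SeminormedAddCommGroup H] [InnerProductSpace ℂ H]

/-- Second-order comparison at a near-maximum, at `1`, of `‖T ·‖` over the unitary group. -/
lemma norm_apply_sq_le_of_almost_max_at_one {T : A →L[ℂ] H} {δ : ℝ}
    (hδ : ∀ U ∈ unitary A, ‖T U‖ ^ 2 ≤ ‖T 1‖ ^ 2 + δ) {h : A}
    (hh : IsSelfAdjoint h) {t : ℝ} (ht : 0 < t) (hth : t * ‖h‖ ≤ 1) :
    ‖T h‖ ^ 2 ≤ (⟪T 1, T (h * h)⟫_ℂ).re + δ / t ^ 2 + ‖T‖ ^ 2 * t ^ 2 * ‖h‖ ^ 4 := by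
  let _ := CStarAlgebra.spectralOrder A
  let _ := CStarAlgebra.spectralOrderedRing A
  set k : A := (t : ℂ) • h with hk_def
  have hk : IsSelfAdjoint k := by
    simp [hk_def, isSelfAdjoint_iff, hh.star_eq]
  have hkn : ‖k‖ = t * ‖h‖ := by simp [hk_def, norm_smul, abs_of_pos ht]
  have hk1 : ‖k‖ ≤ 1 := hkn ▸ hth
  have hU := hk.self_add_I_smul_cfcSqrt_sub_sq_mem_unitary k hk1
  have hs := CStarAlgebra.norm_one_sub_sqrt_one_sub_sq_le hk hk1
  have hk3 : 0 ≤ 1 - k ^ 2 := by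
    obtain _ | _ := subsingleton_or_nontrivial A
    · exact (Subsingleton.elim _ _).le
    have hk2 : 0 ≤ k ^ 2 := by simpa [sq, hk.star_eq] using star_mul_self_nonneg k
    rw [sub_nonneg, ← CStarAlgebra.norm_le_one_iff_of_nonneg (k ^ 2), sq, hk.norm_mul_self]
    exact pow_le_one₀ (norm_nonneg _) hk1
  have hs0 := CFC.sqrt_nonneg (1 - k ^ 2)
  have hss := CFC.sqrt_mul_sqrt_self (1 - k ^ 2)
  set s := CFC.sqrt (1 - k ^ 2)
  have hU' := Unitary.star_mem hU
  have hstar : star (k + Complex.I • s) = k - Complex.I • s := by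
    simp [hk.star_eq, hs0.isSelfAdjoint.star_eq, sub_eq_add_neg]
  rw [hstar] at hU'
  have h1 := hδ _ hU
  have h2 := hδ _ hU'
  have hpar := parallelogram_law_with_norm ℂ (T k) (T (Complex.I • s))
  rw [← map_add, ← map_sub] at hpar
  have hIs : ‖T (Complex.I • s)‖ = ‖T s‖ := by simp [norm_smul]
  rw [hIs] at hpar
  have hsplit : s = 1 - (2⁻¹ : ℂ) • (k * k + (1 - s) * (1 - s)) := by
    have : (1 - s) * (1 - s) = 1 - s - s + s * s := by noncomm_ring
    rw [this, hss, sq]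
    module
  have hTs : T s = T 1 - (2⁻¹ : ℂ) • (T (k * k) + T ((1 - s) * (1 - s))) := by
    conv_lhs => rw [hsplit]
    simp
  have hexp : ‖T s‖ ^ 2 ≥ ‖T 1‖ ^ 2
      - ((⟪T 1, T (k * k)⟫_ℂ).re + (⟪T 1, T ((1 - s) * (1 - s))⟫_ℂ).re) := by
    rw [hTs, @norm_sub_sq ℂ, inner_smul_right, inner_add_right]
    have : RCLike.re ((2⁻¹ : ℂ) * (⟪T 1, T (k * k)⟫_ℂ + ⟪T 1, T ((1 - s) * (1 - s))⟫_ℂ))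
        = 2⁻¹ * ((⟪T 1, T (k * k)⟫_ℂ).re + (⟪T 1, T ((1 - s) * (1 - s))⟫_ℂ).re) := by
      simp
    rw [this]
    nlinarith [sq_nonneg ‖(2⁻¹ : ℂ) • (T (k * k) + T ((1 - s) * (1 - s)))‖]
  have hT1 : ‖T 1‖ ≤ ‖T‖ := by
    obtain _ | _ := subsingleton_or_nontrivial A
    · simp [Subsingleton.elim (1 : A) 0]
    · simpa using T.le_opNorm 1
  have hrem : (⟪T 1, T ((1 - s) * (1 - s))⟫_ℂ).re ≤ ‖T‖ ^ 2 * (t * ‖h‖) ^ 4 :=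
    calc _ ≤ ‖T 1‖ * ‖T ((1 - s) * (1 - s))‖ := re_inner_le_norm (𝕜 := ℂ) _ _
      _ ≤ ‖T‖ * (‖T‖ * (‖k‖ ^ 2 * ‖k‖ ^ 2)) := by
        gcongr
        refine (T.le_opNorm _).trans ?_
        gcongr
        exact (norm_mul_le _ _).trans (by gcongr)
      _ = _ := by rw [hkn]; ring
  have hTk : ‖T k‖ ^ 2 = t ^ 2 * ‖T h‖ ^ 2 := by
    simp [hk_def, norm_smul, mul_pow]
  have hTkk : (⟪T 1, T (k * k)⟫_ℂ).re = t ^ 2 * (⟪T 1, T (h * h)⟫_ℂ).re := by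
    simp only [hk_def, smul_mul_smul_comm, map_smul, inner_smul_right]
    rw [← Complex.ofReal_mul, Complex.re_ofReal_mul, sq]
  rw [hTk] at hpar
  rw [hTkk] at hexp
  refine le_of_mul_le_mul_left ?_ (pow_pos ht 2)
  have : t ^ 2 * ((⟪T 1, T (h * h)⟫_ℂ).re + δ / t ^ 2 + ‖T‖ ^ 2 * t ^ 2 * ‖h‖ ^ 4)
      = t ^ 2 * (⟪T 1, T (h * h)⟫_ℂ).re + δ + ‖T‖ ^ 2 * (t * ‖h‖) ^ 4 := by
    field_simp
  rw [this]
  linarith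

lemma norm_apply_sq_le_re_inner_of_almost_max_at_one {T : A →L[ℂ] H} {δ : ℝ}
    (hδ : ∀ U ∈ unitary A, ‖T U‖ ^ 2 ≤ ‖T 1‖ ^ 2 + δ) {y : A} {B t : ℝ}
    (hy : ‖y‖ ≤ B) (ht : 0 < t) (htB : t * B ≤ 1) :
    ‖T y‖ ^ 2 ≤ (⟪T 1, T (star y * y + y * star y)⟫_ℂ).re
      + 4 * (δ / t ^ 2 + ‖T‖ ^ 2 * t ^ 2 * B ^ 4) := by
  have hre : ‖(ℜ y : A)‖ ≤ B := (realPart.norm_le y).trans hy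
  have him : ‖(ℑ y : A)‖ ≤ B := (imaginaryPart.norm_le y).trans hy
  have h1 := norm_apply_sq_le_of_almost_max_at_one hδ (ℜ y).2 ht
    ((mul_le_mul_of_nonneg_left hre ht.le).trans htB)
  have h2 := norm_apply_sq_le_of_almost_max_at_one hδ (ℑ y).2 ht
    ((mul_le_mul_of_nonneg_left him ht.le).trans htB)
  have h3 : ‖T‖ ^ 2 * t ^ 2 * ‖(ℜ y : A)‖ ^ 4 ≤ ‖T‖ ^ 2 * t ^ 2 * B ^ 4 := by gcongr
  have h4 : ‖T‖ ^ 2 * t ^ 2 * ‖(ℑ y : A)‖ ^ 4 ≤ ‖T‖ ^ 2 * t ^ 2 * B ^ 4 := by gcongr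
  have hsum : ‖T y‖ ≤ ‖T (ℜ y : A)‖ + ‖T (ℑ y : A)‖ := by
    conv_lhs => rw [← realPart_add_I_smul_imaginaryPart y]
    rw [map_add, map_smul]
    exact (norm_add_le _ _).trans (by simp [norm_smul])
  have h5 : ‖T y‖ ^ 2 ≤ 2 * ‖T (ℜ y : A)‖ ^ 2 + 2 * ‖T (ℑ y : A)‖ ^ 2 := by
    nlinarith [pow_le_pow_left₀ (norm_nonneg _) hsum 2,
      sq_nonneg (‖T (ℜ y : A)‖ - ‖T (ℑ y : A)‖)]
  have h6 : (⟪T 1, T (star y * y + y * star y)⟫_ℂ).re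
      = 2 * ((⟪T 1, T ((ℜ y : A) * ℜ y)⟫_ℂ).re + (⟪T 1, T ((ℑ y : A) * ℑ y)⟫_ℂ).re) := by
    rw [star_mul_self_add_self_mul_star]
    simp [inner_add_right, two_mul]
    ring
  rw [h6]
  linarith

/-- **Non-commutative little Grothendieck inequality** for finite families. -/
theorem CStarAlgebra.sum_norm_apply_sq_le (T : A →L[ℂ] H) {ι : Type*} (I : Finset ι) (x : ι → A) :
    ∑ j ∈ I, ‖T (x j)‖ ^ 2
      ≤ ‖T‖ ^ 2 * (‖∑ j ∈ I, star (x j) * x j‖ + ‖∑ j ∈ I, x j * star (x j)‖) := by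
  set B := ∑ j ∈ I, ‖x j‖
  have hB0 : 0 ≤ B := Finset.sum_nonneg fun _ _ ↦ norm_nonneg _
  have hB (j) (hj : j ∈ I) : ‖x j‖ ≤ B :=
    Finset.single_le_sum (f := fun j ↦ ‖x j‖) (fun _ _ ↦ norm_nonneg _) hj
  have hun (U : unitary A) : ‖T U‖ ≤ ‖T‖ := by
    obtain _ | _ := subsingleton_or_nontrivial A
    · simp [Subsingleton.elim (U : A) 0]
    · simpa using T.le_opNorm (U : A)
  set Y := ‖T‖ ^ 2 * (‖∑ j ∈ I, star (x j) * x j‖ + ‖∑ j ∈ I, x j * star (x j)‖)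
  have key : ∀ t ∈ Set.Ioo (0 : ℝ) (1 / (B + 1)), ∑ j ∈ I, ‖T (x j)‖ ^ 2
      ≤ Y + I.card * (4 * (t ^ 2 + ‖T‖ ^ 2 * t ^ 2 * B ^ 4)) := by
    rintro t ⟨ht, htB⟩
    rw [lt_div_iff₀ (by positivity)] at htB
    have hbdd : BddAbove (Set.range fun U : unitary A ↦ ‖T U‖ ^ 2) :=
      ⟨‖T‖ ^ 2, by rintro _ ⟨U, rfl⟩; exact pow_le_pow_left₀ (norm_nonneg _) (hun U) 2⟩
    obtain ⟨U, hU⟩ := exists_lt_of_lt_ciSup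
      (sub_lt_self (⨆ U : unitary A, ‖T U‖ ^ 2) (pow_pos ht 4))
    set S : A →L[ℂ] H := T ∘L ContinuousLinearMap.mul ℂ A U with hS
    have hSapply (a : A) : S a = T (U * a) := rfl
    have hSn : ‖S‖ ≤ ‖T‖ := by
      refine S.opNorm_le_bound (norm_nonneg _) fun a ↦ ?_
      rw [hSapply, ← CStarRing.norm_coe_unitary_mul U a]
      exact T.le_opNorm _
    have hδ : ∀ V ∈ unitary A, ‖S V‖ ^ 2 ≤ ‖S 1‖ ^ 2 + t ^ 4 := by
      intro V hV
      have := le_ciSup hbdd (U * ⟨V, hV⟩)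
      simp only [hSapply, mul_one]
      simp only [Submonoid.coe_mul] at this
      linarith
    set y : ι → A := fun j ↦ star (U : A) * x j with hy
    have hSy (j) : S (y j) = T (x j) := by
      simp [hSapply, hy, ← mul_assoc]
    have hyn (j) : ‖y j‖ = ‖x j‖ := by
      simpa using CStarRing.norm_coe_unitary_mul (star U) (x j)
    have hterm (j) (hj : j ∈ I) : ‖T (x j)‖ ^ 2
        ≤ (⟪S 1, S (star (y j) * y j + y j * star (y j))⟫_ℂ).re
          + 4 * (t ^ 2 + ‖T‖ ^ 2 * t ^ 2 * B ^ 4) := by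
      rw [← hSy]
      refine (norm_apply_sq_le_re_inner_of_almost_max_at_one hδ ((hyn j).le.trans (hB j hj)) ht
        (by nlinarith)).trans ?_
      have : t ^ 4 / t ^ 2 = t ^ 2 := by field_simp
      rw [this]
      gcongr
    refine (Finset.sum_le_sum hterm).trans ?_
    rw [Finset.sum_add_distrib, Finset.sum_const, nsmul_eq_mul]
    gcongr
    rw [← Complex.re_sum, ← inner_sum, ← map_sum, Finset.sum_add_distrib]
    have e1 : ∑ j ∈ I, star (y j) * y j = ∑ j ∈ I, star (x j) * x j := by
      refine Finset.sum_congr rfl fun j _ ↦ ?_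
      simp only [hy, star_mul, star_star]
      rw [mul_assoc, ← mul_assoc (U : A)]
      simp
    have e2 : ∑ j ∈ I, y j * star (y j) = star (U : A) * (∑ j ∈ I, x j * star (x j)) * U := by
      simp [hy, Finset.mul_sum, Finset.sum_mul, mul_assoc]
    have n2 : ‖star (U : A) * (∑ j ∈ I, x j * star (x j)) * U‖ = ‖∑ j ∈ I, x j * star (x j)‖ := by
      rw [CStarRing.norm_mul_coe_unitary]
      simpa using CStarRing.norm_coe_unitary_mul (star U) (∑ j ∈ I, x j * star (x j))
    calc _ ≤ ‖S 1‖ * ‖S (∑ j ∈ I, star (y j) * y j + ∑ j ∈ I, y j * star (y j))‖ :=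
          re_inner_le_norm (𝕜 := ℂ) _ _
      _ ≤ ‖T‖ * (‖T‖ * (‖∑ j ∈ I, star (y j) * y j‖ + ‖∑ j ∈ I, y j * star (y j)‖)) := by
        gcongr
        · simpa [hSapply] using hun U
        · exact (S.le_of_opNorm_le hSn _).trans (by gcongr; exact norm_add_le _ _)
      _ = Y := by rw [e1, e2, n2, ← mul_assoc, ← sq]
  have hlim : Filter.Tendsto (fun t : ℝ ↦ Y + I.card * (4 * (t ^ 2 + ‖T‖ ^ 2 * t ^ 2 * B ^ 4)))
      (nhdsWithin 0 (Set.Ioi 0)) (nhds Y) := by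
    refine Filter.Tendsto.mono_left ?_ nhdsWithin_le_nhds
    refine Continuous.tendsto' (by fun_prop) _ _ (by simp)
  exact ge_of_tendsto hlim (Filter.eventually_of_mem (Ioo_mem_nhdsGT (by positivity)) key)

end LittleGrothendieck

theorem CStarAlgebra.norm_sum_star_apply_mul_apply_le {A₁ A₂ : Type*}
    [CStarAlgebra A₁] [CStarAlgebra A₂] (u : A₁ →L[ℂ] A₂) {ι : Type*}
    (I : Finset ι) (x : ι → A₁) :
    ‖∑ j ∈ I, star (u (x j)) * u (x j)‖
      ≤ ‖u‖ ^ 2 * (‖∑ j ∈ I, star (x j) * x j‖ + ‖∑ j ∈ I, x j * star (x j)‖) := by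
  let _ := CStarAlgebra.spectralOrder A₂
  let _ := CStarAlgebra.spectralOrderedRing A₂
  obtain _ | _ := subsingleton_or_nontrivial A₂
  · rw [Subsingleton.elim (∑ j ∈ I, star (u (x j)) * u (x j)) 0, norm_zero]
    positivity
  obtain ⟨f, hf, hfb⟩ := CStarAlgebra.exists_state_apply_eq_norm
    (Finset.sum_nonneg fun j (_ : j ∈ I) ↦ star_mul_self_nonneg (u (x j)))
  have hnorm (a : A₂) : ‖f.toPreGNS a‖ ≤ 1 * ‖a‖ := by
    rw [one_mul, ← sq_le_sq₀ (norm_nonneg _) (norm_nonneg _)]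
    calc ‖f.toPreGNS a‖ ^ 2 = ‖f (star a * a)‖ := by
          rw [← Real.norm_of_nonneg (sq_nonneg ‖f.toPreGNS a‖), ← Complex.norm_real,
            Complex.ofReal_pow, f.preGNS_norm_sq, f.ofPreGNS_toPreGNS]
      _ ≤ ‖a‖ ^ 2 := (hf _).trans (by rw [CStarRing.norm_star_mul_self, sq])
  set q : A₂ →L[ℂ] f.PreGNS := f.toPreGNS.toLinearMap.mkContinuous 1 hnorm
  have hq : ‖q ∘L u‖ ≤ ‖u‖ := by
    refine (q ∘L u).opNorm_le_bound (norm_nonneg _) fun a ↦ ?_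
    exact (hnorm (u a)).trans ((one_mul _).le.trans (u.le_opNorm a))
  have hsum : ∑ j ∈ I, ‖(q ∘L u) (x j)‖ ^ 2 = ‖∑ j ∈ I, star (u (x j)) * u (x j)‖ := by
    apply Complex.ofReal_injective
    rw [← hfb, map_sum, Complex.ofReal_sum]
    refine Finset.sum_congr rfl fun j _ ↦ ?_
    rw [Complex.ofReal_pow, f.preGNS_norm_sq]
    rfl
  rw [← hsum]
  refine (CStarAlgebra.sum_norm_apply_sq_le (q ∘L u) I x).trans ?_
  gcongr

/-- **Row–column norm stability under bounded maps between C*-algebras** (a corollary of the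
non-commutative little Grothendieck theorem): for any bounded linear map `u : A₁ → A₂`
between unital C*-algebras and any finite family `(x j)`,
`max(‖∑ (u x j)*(u x j)‖^{1/2}, ‖∑ (u x j)(u x j)*‖^{1/2})
  ≤ √2·‖u‖·max(‖∑ x j* x j‖^{1/2}, ‖∑ x j x j*‖^{1/2})`. -/
theorem rc_norm_bound_of_bounded
    (A₁ A₂ : Type*) [CStarAlgebra A₁] [CStarAlgebra A₂]
    (u : A₁ →L[ℂ] A₂) (n : ℕ) (x : Fin n → A₁) :
    max (Real.sqrt ‖∑ j, star (u (x j)) * u (x j)‖)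
        (Real.sqrt ‖∑ j, u (x j) * star (u (x j))‖)
      ≤ Real.sqrt 2 * ‖u‖ *
        max (Real.sqrt ‖∑ j, star (x j) * x j‖)
            (Real.sqrt ‖∑ j, x j * star (x j)‖) := by
  set C := ‖∑ j, star (x j) * x j‖
  set R := ‖∑ j, x j * star (x j)‖
  have hcol : ‖∑ j, star (u (x j)) * u (x j)‖ ≤ ‖u‖ ^ 2 * (C + R) :=
    CStarAlgebra.norm_sum_star_apply_mul_apply_le u Finset.univ x
  have hrow : ‖∑ j, u (x j) * star (u (x j))‖ ≤ ‖u‖ ^ 2 * (C + R) := by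
    let v : A₁ →L[ℂ] A₂ := LinearMap.mkContinuous
      { toFun := fun a ↦ star (u (star a))
        map_add' := by simp
        map_smul' := by simp } ‖u‖ fun a ↦ by simpa using u.le_opNorm (star a)
    have hv : ‖v‖ ≤ ‖u‖ := LinearMap.mkContinuous_norm_le _ (norm_nonneg _) _
    have hvx (a : A₁) : v (star a) = star (u a) := congrArg (fun b ↦ star (u b)) (star_star a)
    have h := CStarAlgebra.norm_sum_star_apply_mul_apply_le v Finset.univ fun j ↦ star (x j)
    simp only [hvx, star_star] at h
    refine h.trans ?_
    rw [add_comm]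
    gcongr
  have hmax : ‖u‖ ^ 2 * (C + R) ≤ (√2 * ‖u‖ * max √C √R) ^ 2 := by
    have hC : C ≤ max √C √R ^ 2 := (Real.sqrt_le_left (by positivity)).1 (le_max_left _ _)
    have hR : R ≤ max √C √R ^ 2 := (Real.sqrt_le_left (by positivity)).1 (le_max_right _ _)
    rw [mul_pow, mul_pow, Real.sq_sqrt zero_le_two]
    nlinarith [mul_le_mul_of_nonneg_left (add_le_add hC hR) (sq_nonneg ‖u‖)]
  exact max_le (Real.sqrt_le_iff.2 ⟨by positivity, hcol.trans hmax⟩)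
    (Real.sqrt_le_iff.2 ⟨by positivity, hrow.trans hmax⟩)
end

section
/- Let M be a unital C*-algebra and let x_1, …, x_n ∈ M be self-adjoint (x_k* = x_k). For ε ∈ {-1,1}ⁿ put S(ε) = ∑_{k=1}^n ε_k·x_k. Then ‖2^{-n}·∑_{ε∈{-1,1}ⁿ} S(ε)⁴‖ ≤ 3·‖∑_{k=1}^n x_k²‖². -/
section Signs

variable {R : Type*}

/-- Splitting off the first sign in a sum over all signed sums. -/
theorem sum_signs_succ [AddCommGroup R] {N : Type*} [AddCommMonoid N] {n : ℕ}
    (x : Fin (n + 1) → R) (f : R → N) :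
    ∑ ε : Fin (n + 1) → Bool, f (∑ k, if ε k then x k else -x k) =
      ∑ ε : Fin n → Bool, (f (x 0 + ∑ k, if ε k then x k.succ else -x k.succ) +
        f (-x 0 + ∑ k, if ε k then x k.succ else -x k.succ)) := by
  rw [← (Fin.consEquiv fun _ => Bool).sum_comp, Fintype.sum_prod_type, Fintype.sum_bool,
    ← Finset.sum_add_distrib]
  simp [Fin.consEquiv, Fin.sum_univ_succ]

/-- Orthogonality of the Rademacher signs, for sums sandwiching a fixed element. -/
theorem sum_signs_mul_mul [Ring R] {n : ℕ} (x : Fin n → R) (y : R) :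
    ∑ ε : Fin n → Bool, (∑ k, if ε k then x k else -x k) * y *
      (∑ k, if ε k then x k else -x k) = 2 ^ n • ∑ k, x k * y * x k := by
  induction n with
  | zero => simp
  | succ n ih =>
    rw [sum_signs_succ x fun s => s * y * s]
    have h (s : R) : (x 0 + s) * y * (x 0 + s) + (-x 0 + s) * y * (-x 0 + s) =
        2 • (x 0 * y * x 0 + s * y * s) := by noncomm_ring
    simp only [h, ← Finset.smul_sum, Finset.sum_add_distrib, ih fun k => x k.succ]
    simp [Fin.sum_univ_succ, pow_succ', mul_smul]

theorem sum_signs_sq [Ring R] {n : ℕ} (x : Fin n → R) :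
    ∑ ε : Fin n → Bool, (∑ k, if ε k then x k else -x k) ^ 2 = 2 ^ n • ∑ k, x k ^ 2 := by
  simpa [sq] using sum_signs_mul_mul x 1

theorem IsSelfAdjoint.sum_signs [Ring R] [StarRing R] {n : ℕ} {x : Fin n → R}
    (hx : ∀ k, IsSelfAdjoint (x k)) (ε : Fin n → Bool) :
    IsSelfAdjoint (∑ k, if ε k then x k else -x k) := by
  refine isSelfAdjoint_sum _ fun k _ => ?_
  split_ifs
  exacts [hx k, (hx k).neg]

variable [Ring R] [StarRing R] [PartialOrder R] [StarOrderedRing R]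

theorem IsSelfAdjoint.pow_four_nonneg {a : R} (ha : IsSelfAdjoint a) : 0 ≤ a ^ 4 := by
  have h := (ha.pow 2).mul_self_nonneg
  rwa [← pow_add] at h

/-- Averaging the fourth power over one sign, the crossed terms `a * s * a * s` being bounded by
positivity of `star (s * a - a * s) * (s * a - a * s)`. -/
theorem IsSelfAdjoint.add_pow_four_add_neg_add_pow_four_le {a s : R} (ha : IsSelfAdjoint a)
    (hs : IsSelfAdjoint s) :
    (a + s) ^ 4 + (-a + s) ^ 4 ≤ 2 • (s ^ 4 + a ^ 4 + s ^ 2 * a ^ 2 + a ^ 2 * s ^ 2 +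
      2 • (s * a ^ 2 * s) + 2 • (a * s ^ 2 * a)) := by
  have h := star_mul_self_nonneg (s * a - a * s)
  rw [star_sub, star_mul, star_mul, ha.star_eq, hs.star_eq] at h
  rw [← sub_nonneg]
  convert nsmul_nonneg h 2 using 1
  noncomm_ring

theorem sum_signs_pow_four_le {n : ℕ} (x : Fin n → R) (hx : ∀ k, IsSelfAdjoint (x k)) :
    ∑ ε : Fin n → Bool, (∑ k, if ε k then x k else -x k) ^ 4 ≤
      2 ^ n • ((∑ k, x k ^ 2) ^ 2 + 2 • ∑ k, x k * (∑ j, x j ^ 2) * x k) := by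
  induction n with
  | zero => simp
  | succ n ih =>
    rw [sum_signs_succ x fun s => s ^ 4]
    refine (Finset.sum_le_sum fun ε _ =>
      (hx 0).add_pow_four_add_neg_add_pow_four_le (.sum_signs (fun k => hx k.succ) ε)).trans ?_
    simp only [← Finset.smul_sum, Finset.sum_add_distrib, ← Finset.sum_mul, ← Finset.mul_sum,
      sum_signs_mul_mul, sum_signs_sq, pow_succ' 2 n, mul_smul]
    refine nsmul_le_nsmul_right ?_ 2
    have hsum : ∑ k : Fin n, x k.succ * (x 0 ^ 2 + ∑ j : Fin n, x j.succ ^ 2) * x k.succ =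
        ∑ k : Fin n, x k.succ * x 0 ^ 2 * x k.succ +
          ∑ k : Fin n, x k.succ * (∑ j : Fin n, x j.succ ^ 2) * x k.succ := by
      simp only [mul_add, add_mul, Finset.sum_add_distrib]
    have ih' := ih (fun k => x k.succ) fun k => hx k.succ
    have h0 := nsmul_nonneg (nsmul_nonneg (hx 0).pow_four_nonneg 2) (2 ^ n)
    simp only [Fin.sum_univ_succ, hsum, Finset.sum_const, Finset.card_univ, Fintype.card_fun,
      Fintype.card_bool, Fintype.card_fin]
    rw [← sub_nonneg]
    convert add_nonneg (sub_nonneg.2 ih') h0 using 1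
    simp only [smul_mul_assoc, mul_smul_comm, mul_add, add_mul, mul_assoc, pow_succ (x 0), pow_zero,
      one_mul, sq (_ + _)]
    simp only [← sq (∑ _, _)]
    module

end Signs

/-- **Fourth-moment bound for Rademacher averages in a C*-algebra** (key lemma for the
non-commutative Khintchine inequality): if `x₁, …, xₙ` are self-adjoint elements of a
unital C*-algebra and `S(ε) = ∑ ε k · x k` for signs `ε ∈ {-1,1}ⁿ`, then
`‖2⁻ⁿ·∑_ε S(ε)⁴‖ ≤ 3·‖∑ x k²‖²`.  (Signs are encoded by `ε : Fin n → Bool`, with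
`ε k · x k` given by `x k` if `ε k` and `-x k` otherwise.) -/
theorem rademacher_fourth_moment_cstar
    (M : Type*) [CStarAlgebra M] (n : ℕ) (x : Fin n → M)
    (hx : ∀ k, star (x k) = x k) :
    ‖((2 : ℂ) ^ n)⁻¹ • ∑ ε : Fin n → Bool, (∑ k, if ε k then x k else -x k) ^ 4‖
      ≤ 3 * ‖∑ k, x k ^ 2‖ ^ 2 := by
  let _ := CStarAlgebra.spectralOrder M
  have _ := CStarAlgebra.spectralOrderedRing M
  set A := ∑ k, x k ^ 2 with hA
  have hA0 : 0 ≤ A := Finset.sum_nonneg fun k _ => IsSelfAdjoint.sq_nonneg (hx k)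
  set E := ∑ ε : Fin n → Bool, (∑ k, if ε k then x k else -x k) ^ 4
  have hE0 : 0 ≤ E := Finset.sum_nonneg fun ε _ =>
    (IsSelfAdjoint.sum_signs (fun k => hx k) ε).pow_four_nonneg
  have hsum : ∑ k, x k * A * x k ≤ ‖A‖ • A := by
    rw [hA, Finset.smul_sum, ← hA]
    refine Finset.sum_le_sum fun k _ => ?_
    simpa [hx k, sq] using CStarAlgebra.star_left_conjugate_le_norm_smul (a := x k) (b := A)
  have hle : E ≤ 2 ^ n • (A ^ 2 + 2 • ‖A‖ • A) :=
    (sum_signs_pow_four_le x hx).trans (by gcongr)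
  have hnorm : ‖A ^ 2 + 2 • ‖A‖ • A‖ ≤ 3 * ‖A‖ ^ 2 := by
    calc _ ≤ ‖A ^ 2‖ + 2 • ‖‖A‖ • A‖ :=
        (norm_add_le _ _).trans (by gcongr; exact norm_nsmul_le.trans_eq (nsmul_eq_mul _ _).symm)
      _ ≤ ‖A‖ ^ 2 + 2 • (‖A‖ * ‖A‖) := by
        gcongr
        · exact norm_pow_le' A two_pos
        · simp [norm_smul]
      _ = 3 * ‖A‖ ^ 2 := by simp; ring
  have hEn : ‖E‖ ≤ 2 ^ n * (3 * ‖A‖ ^ 2) := by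
    calc ‖E‖ ≤ _ := CStarAlgebra.norm_le_norm_of_nonneg_of_le hE0 hle
      _ ≤ _ := norm_nsmul_le
      _ ≤ _ := by push_cast; exact mul_le_mul_of_nonneg_left hnorm (by positivity)
  rw [norm_smul, norm_inv, norm_pow, Complex.norm_ofNat]
  exact (inv_mul_le_iff₀ (by positivity)).2 hEn
end
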